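/- arXiv:2209.08201 — 4 statements merged into one kernel-verified Lean document; each statement's English description precedes it below -/
import Mathlib

section
/- For all integers a ≥ 2 and i ≥ 1, the set Skyt(a,i,2) of skew standard Young tableaux is in bijection with the set of Dyck paths of semilength a+2i with exactly i+1 long ascents and no singletons; that is, Skyt(a,i,2) and Dyck(a+2i, i+1, 0) have the same cardinality. -/
/-! ## Skew Young tableaux -/

/-- Cells (row, col), 0-indexed, of the skew diagram with `b-2` single cells in
column `i` on top, two full rows of length `i+1`, and `a-2` single cells in column `0` below. -/
def skytCells (a i b : ℕ) : Finset (ℕ × ℕ) :=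
  (Finset.range (a + b - 2) ×ˢ Finset.range (i + 1)).filter fun c =>
    (c.1 + 2 < b → c.2 = i) ∧ (b ≤ c.1 → c.2 = 0)

/-- Skew standard Young tableaux of shape `[(i+1)^b, 1^(a-2)] / [(i-1)^(b-2)]`,
modelled as fillings of `skytCells a i b` by `1, …, a+b+2i-2`, increasing along
rows and columns, and vanishing outside the diagram. -/
def SkytSet (a i b : ℕ) : Set ((ℕ × ℕ) → ℕ) :=
  {f | (∀ c, c ∉ skytCells a i b → f c = 0) ∧
    Set.BijOn f (skytCells a i b : Set (ℕ × ℕ)) (Finset.Icc 1 (a + b + 2 * i - 2) : Set ℕ) ∧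
    (∀ c ∈ skytCells a i b, ∀ d ∈ skytCells a i b, c.1 = d.1 → c.2 < d.2 → f c < f d) ∧
    (∀ c ∈ skytCells a i b, ∀ d ∈ skytCells a i b, c.2 = d.2 → c.1 < d.1 → f c < f d)}

/-! ## Dyck paths -/

/-- Lengths of the maximal ascents (runs of `true`) of a word. -/
def ascentLengths (w : List Bool) : List ℕ :=
  ((w.splitBy (· == ·)).filter fun r => r.headD false).map List.length

/-- `DyckSet n l s`: Dyck paths (`true` = up-step) of semilength `n` with exactly `l`
long ascents, exactly `s` singletons, and no singleton after the last long ascent. -/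
def DyckSet (n l s : ℕ) : Set (List Bool) :=
  {w | w.length = 2 * n ∧ w.count true = w.count false ∧
    (∀ p, p <+: w → p.count false ≤ p.count true) ∧
    ((ascentLengths w).filter fun x => decide (2 ≤ x)).length = l ∧
    ((ascentLengths w).filter fun x => decide (x = 1)).length = s ∧
    ∀ j, (ascentLengths w).getD j 0 = 1 → ∃ k, j < k ∧ 2 ≤ (ascentLengths w).getD k 0}

/-! ## Dissections and triangulations -/

/-- A chord of the convex `n`-gon (vertices `1, …, n` counterclockwise): a pair of
non-adjacent vertices, recorded with the smaller endpoint first. -/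
def IsChord (n : ℕ) (c : ℕ × ℕ) : Prop :=
  1 ≤ c.1 ∧ c.1 + 1 < c.2 ∧ c.2 ≤ n ∧ ¬(c.1 = 1 ∧ c.2 = n)

/-- Two chords cross in the interior of the polygon. -/
def Crosses (c d : ℕ × ℕ) : Prop :=
  (c.1 < d.1 ∧ d.1 < c.2 ∧ c.2 < d.2) ∨ (d.1 < c.1 ∧ c.1 < d.2 ∧ d.2 < c.2)

/-- A dissection of the `n`-gon: a set of pairwise non-crossing chords. -/
def IsDissection (n : ℕ) (S : Finset (ℕ × ℕ)) : Prop :=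
  (∀ c ∈ S, IsChord n c) ∧ (∀ c ∈ S, ∀ d ∈ S, c ≠ d → ¬Crosses c d)

/-- `DisSet n k`: dissections of the `n`-gon with exactly `k` chords. -/
def DisSet (n k : ℕ) : Set (Finset (ℕ × ℕ)) :=
  {S | IsDissection n S ∧ S.card = k}

/-- A triangulation of the `n`-gon: a maximal set of pairwise non-crossing chords. -/
def IsTriangulation (n : ℕ) (S : Finset (ℕ × ℕ)) : Prop :=
  IsDissection n S ∧ ∀ c, IsChord n c → (∀ d ∈ S, ¬Crosses c d) → c ∈ S

/-- Fuelled recursive computation of the fan decomposition of the triangulation induced by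
the chord set `S` on the vertex interval `[p, r]`: returns the list of pairs
(origin of fan, number of triangles of the fan), in the order of the recursive
fan decomposition (fan at the smallest vertex first, then the decompositions of the
sub-polygons in counterclockwise order). -/
def fanListAux (S : Finset (ℕ × ℕ)) : ℕ → ℕ → ℕ → List (ℕ × ℕ)
  | 0, _, _ => []
  | fuel + 1, p, r =>
    if r ≤ p + 1 then []
    else
      let ws := ((S.filter fun c => c.1 = p ∧ p + 1 < c.2 ∧ c.2 < r).image Prod.snd).sort (· ≤ ·)
      let link := (p + 1) :: (ws ++ [r])
      (p, ws.length + 1) :: (link.zip link.tail).flatMap fun q => fanListAux S fuel q.1 q.2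

/-- The fan decomposition `F(T)` of the triangulation `S` of the polygon on the vertex
interval `[p, r]`, as a list of (origin, fan size) pairs. -/
def fanList (S : Finset (ℕ × ℕ)) (p r : ℕ) : List (ℕ × ℕ) :=
  fanListAux S (r - p) p r

/-- The sequence `δ(T) = (d_1, …, d_{k-1})` of differences of consecutive fan origins. -/
def deltaList (L : List (ℕ × ℕ)) : List ℕ :=
  ((L.map Prod.fst).zip (L.map Prod.fst).tail).map fun q => q.2 - q.1

/-- `TriSet n t s`: triangulations of the `n`-gon whose fan decomposition has `t + s` fans,
exactly `s` of them singular, the last one not singular. -/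
def TriSet (n t s : ℕ) : Set (Finset (ℕ × ℕ)) :=
  {S | IsTriangulation n S ∧
    (fanList S 1 n).length = t + s ∧
    ((fanList S 1 n).filter fun fan => decide (fan.2 = 1)).length = s ∧
    ((fanList S 1 n).getLastD (0, 0)).2 ≠ 1}

/-! ## Ordered set partitions -/

/-- The minimum of a finite set of naturals (0 by convention for `∅`). -/
def blockMin (A : Finset ℕ) : ℕ := (A.sort (· ≤ ·)).getD 0 0

/-- The second-smallest element of a finite set of naturals. -/
def blockSndMin (A : Finset ℕ) : ℕ := (A.sort (· ≤ ·)).getD 1 0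

/-- An ordered set partition of `{1, …, n}` : a list of nonempty pairwise disjoint
blocks whose union is `{1, …, n}`. -/
def IsOSP (n : ℕ) (L : List (Finset ℕ)) : Prop :=
  (∀ A ∈ L, A.Nonempty) ∧ List.Pairwise Disjoint L ∧
    L.foldr (· ∪ ·) ∅ = Finset.Icc 1 n

/-- Nomincreasing: the blocks' minima strictly increase, and the second-smallest elements
of the blocks of size at least 2 strictly increase (in the order the blocks appear). -/
def Nomincreasing (L : List (Finset ℕ)) : Prop :=
  (L.map blockMin).Chain' (· < ·) ∧
    ((L.filter fun A => decide (2 ≤ A.card)).map blockSndMin).Chain' (· < ·)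

/-- The word `U^{a_1} D^{x_2-x_1} ⋯ U^{a_t} D^{n-x_t+x_1}` attached to an ordered set
partition of `{1, …, n}` with minima `x_j` and block sizes `a_j`. -/
def ospWord (n : ℕ) (L : List (Finset ℕ)) : List Bool :=
  let xs := L.map blockMin
  let ds := ((xs.zip xs.tail).map fun q => q.2 - q.1) ++ [n - xs.getLastD 0 + xs.headD 0]
  ((L.map Finset.card).zip ds).flatMap fun q =>
    List.replicate q.1 true ++ List.replicate q.2 false

/-! ## The map `Nom` -/

/-- The `j`-th block (0-indexed) of `Nom(λ)` for a tableau `f ∈ SkytSet a i b`. -/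
def nomBlock (a i b : ℕ) (f : ℕ × ℕ → ℕ) (j : ℕ) : Finset ℕ :=
  let N := a + b + 2 * i - 2
  let X := ((skytCells a i b).filter fun c => c.1 + 1 < b).image f
  let x := (X.sort (· ≤ ·)).getD j 0
  let row := (Finset.range (i + 1)).filter fun c => f (b - 2, c) = x
  if row.Nonempty then
    let col := (row.sort (· ≤ ·)).getD 0 0
    if col = i then insert x (Finset.Icc (f (b - 1, col)) N \ X)
    else insert x (Finset.Icc (f (b - 1, col)) (f (b - 1, col + 1) - 1) \ X)
  else {x}

/-- The nomincreasing ordered set partition `Nom(λ)` of a tableau `λ ∈ SkytSet a i b`. -/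
def Nom (a i b : ℕ) (f : ℕ × ℕ → ℕ) : List (Finset ℕ) :=
  (List.range (i + b - 1)).map (nomBlock a i b f)

/-- The Dyck word `U^{u_1} D^{d_1} ⋯ U^{u_{t+s}} D^{d_{t+s}}` attached to a triangulation. -/
def triWord (n : ℕ) (S : Finset (ℕ × ℕ)) : List Bool :=
  let L := fanList S 1 n
  let xs := L.map Prod.fst
  let ds := deltaList L ++ [n - xs.getLastD 0 + xs.headD 0 - 2]
  ((L.map Prod.snd).zip ds).flatMap fun q =>
    List.replicate q.1 true ++ List.replicate q.2 false

/-! ## Dyck words from lists of ascents and descents -/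

/-- The runs `U^{u_1+1}, D^{d_1}, …, U^{u_t+1}, D^{d_t}` attached to a list of pairs `(u_j, d_j)`. -/
def runs (L : List (ℕ × ℕ)) : List (List Bool) :=
  L.flatMap fun q => [List.replicate (q.1 + 1) true, List.replicate q.2 false]

/-- The word `U^{u_1+1} D^{d_1} ⋯ U^{u_t+1} D^{d_t}` attached to a list of pairs `(u_j, d_j)`. -/
def runWord (L : List (ℕ × ℕ)) : List Bool := (runs L).flatten

lemma runWord_nil : runWord [] = [] := rfl

lemma runWord_cons (q : ℕ × ℕ) (L : List (ℕ × ℕ)) :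
    runWord (q :: L) =
      List.replicate (q.1 + 1) true ++ (List.replicate q.2 false ++ runWord L) := by
  simp [runWord, runs]

lemma runWord_append (L M : List (ℕ × ℕ)) : runWord (L ++ M) = runWord L ++ runWord M := by
  simp [runWord, runs]

lemma count_true_runWord (L : List (ℕ × ℕ)) :
    (runWord L).count true = (L.map Prod.fst).sum + L.length := by
  induction L with
  | nil => rfl
  | cons q L ih => simp [runWord_cons, List.count_append, ih, List.count_replicate]; omega

lemma count_false_runWord (L : List (ℕ × ℕ)) :
    (runWord L).count false = (L.map Prod.snd).sum := by
  induction L with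
  | nil => rfl
  | cons q L ih => simp [runWord_cons, List.count_append, ih, List.count_replicate]

lemma isChain_runs (L : List (ℕ × ℕ)) (hL : ∀ q ∈ L, 1 ≤ q.2) :
    (runs L).IsChain fun a b => ∃ ha hb, (a.getLast ha == b.head hb) = false := by
  induction L with
  | nil => simp [runs]
  | cons q L ih =>
    have hq : 1 ≤ q.2 := hL q (by simp)
    have ih' := ih fun q hq => hL q (by simp [hq])
    have e : runs (q :: L) =
      List.replicate (q.1 + 1) true :: List.replicate q.2 false :: runs L := rfl
    rw [e, List.isChain_cons_cons]
    refine ⟨⟨by simp, by simp; omega, by simp⟩, ?_⟩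
    rcases L with _ | ⟨r, L⟩
    · simp [runs]
    · have e' : runs (r :: L) =
        List.replicate (r.1 + 1) true :: List.replicate r.2 false :: runs L := rfl
      rw [e'] at ih' ⊢
      rw [List.isChain_cons_cons]
      exact ⟨⟨by simp; omega, by simp, by simp⟩, ih'⟩

lemma splitBy_runWord (L : List (ℕ × ℕ)) (hL : ∀ q ∈ L, 1 ≤ q.2) :
    (runWord L).splitBy (· == ·) = runs L := by
  refine List.splitBy_flatten ?_ ?_ (isChain_runs L hL)
  · simp only [runs, List.mem_flatMap, not_exists, not_and]
    intro q hq h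
    have := hL q hq
    simp at h
    omega
  · simp only [runs, List.mem_flatMap]
    rintro m ⟨q, -, hm⟩
    simp only [List.mem_cons, List.not_mem_nil, or_false] at hm
    rcases hm with rfl | rfl <;> exact List.isChain_replicate_of_rel _ (by simp)

lemma ascentLengths_runWord (L : List (ℕ × ℕ)) (hL : ∀ q ∈ L, 1 ≤ q.2) :
    ascentLengths (runWord L) = L.map fun q => q.1 + 1 := by
  rw [ascentLengths, splitBy_runWord L hL]
  induction L with
  | nil => rfl
  | cons q L ih =>
    have ih' := ih fun q hq => hL q (by simp [hq])
    obtain ⟨d, hd⟩ : ∃ d, q.2 = d + 1 := ⟨q.2 - 1, by have := hL q (by simp); omega⟩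
    have e : runs (q :: L) =
      List.replicate (q.1 + 1) true :: List.replicate q.2 false :: runs L := rfl
    rw [e, hd, List.filter_cons_of_pos (by simp [List.replicate_succ]),
      List.filter_cons_of_neg (by simp [List.replicate_succ]), List.map_cons, ih']
    simp

lemma runs_injective : Function.Injective runs := by
  intro L
  induction L with
  | nil =>
    rintro (_ | ⟨q, M⟩) h
    · rfl
    · simp [runs] at h
  | cons p L ih =>
    rintro (_ | ⟨q, M⟩) h
    · simp [runs] at h
    · have h' : List.replicate (p.1 + 1) true :: List.replicate p.2 false :: runs L =
          List.replicate (q.1 + 1) true :: List.replicate q.2 false :: runs M := h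
      simp only [List.cons.injEq] at h'
      obtain ⟨h1, h2, h3⟩ := h'
      have e1 := congrArg List.length h1
      have e2 := congrArg List.length h2
      simp only [List.length_replicate] at e1 e2
      rw [ih h3, Prod.ext (by omega : p.1 = q.1) e2]

lemma exists_eq_replicate_append_runWord (w : List Bool) (hw : ∀ v, w ≠ v ++ [true]) :
    ∃ m L, (∀ q ∈ L, 1 ≤ q.2) ∧ w = List.replicate m false ++ runWord L := by
  induction w with
  | nil => exact ⟨0, [], by simp, rfl⟩
  | cons b w ih =>
    obtain ⟨m, L, hL, rfl⟩ := ih fun v hv => hw (b :: v) (by simp [hv])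
    cases b with
    | false => exact ⟨m + 1, L, hL, by simp [List.replicate_succ]⟩
    | true =>
      rcases m with _ | m
      · rcases L with _ | ⟨q, L⟩
        · exact absurd rfl (hw [])
        · refine ⟨0, (q.1 + 1, q.2) :: L, ?_, ?_⟩
          · simpa using hL
          · simp [runWord_cons, List.replicate_succ]
      · refine ⟨0, (0, m + 1) :: L, ?_, ?_⟩
        · simpa using hL
        · simp [runWord_cons]

lemma count_false_le_of_prefix_runWord (L : List (ℕ × ℕ)) (h : ℕ)
    (hL : ∀ j ≤ L.length,
      ((L.map Prod.snd).take j).sum ≤ h + (((L.map Prod.fst).take j).sum + j))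
    (p : List Bool) (hp : p <+: runWord L) : p.count false ≤ h + p.count true := by
  induction L generalizing h p with
  | nil =>
    rw [runWord_nil, List.prefix_nil] at hp
    simp [hp]
  | cons q L ih =>
    have h1 := hL 1 (by simp)
    simp only [List.map_cons, List.take_succ_cons, List.take_zero, List.sum_cons,
      List.sum_nil] at h1
    rw [runWord_cons] at hp
    obtain ⟨t, ht⟩ := hp
    rcases List.append_eq_append_iff.1 ht with ⟨s, hs, -⟩ | ⟨p', rfl, ht'⟩
    · rw [(List.prefix_replicate_iff.1 ⟨s, hs.symm⟩).2]
      simp [List.count_replicate]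
    · rcases List.append_eq_append_iff.1 ht'.symm with ⟨s, hs, -⟩ | ⟨p'', rfl, ht''⟩
      · obtain ⟨hle, he⟩ := List.prefix_replicate_iff.1 ⟨s, hs.symm⟩
        rw [he]
        simp [List.count_append, List.count_replicate]
        omega
      · have := ih (h + (q.1 + 1) - q.2) (fun j hj => by
          have := hL (j + 1) (by simpa using hj)
          simp only [List.map_cons, List.take_succ_cons, List.sum_cons] at this
          omega) p'' ⟨t, ht''.symm⟩
        simp only [List.count_append, List.count_replicate]
        simp
        omega

/-- The lists `((u_1, d_1), …, (u_k, d_k))` of pairs of positive integers that describe the Dyck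
paths `U^{u_1+1} D^{d_1} ⋯ U^{u_k+1} D^{d_k}` of semilength `N`. -/
def dyckRuns (N k : ℕ) : Set (List (ℕ × ℕ)) :=
  {L | L.length = k ∧ (∀ q ∈ L, 1 ≤ q.1 ∧ 1 ≤ q.2) ∧ (L.map Prod.fst).sum + k = N ∧
    (L.map Prod.snd).sum = N ∧
    ∀ j ≤ k, ((L.map Prod.snd).take j).sum ≤ ((L.map Prod.fst).take j).sum + j}

lemma length_eq_count_true_add_count_false (w : List Bool) :
    w.length = w.count true + w.count false := by
  exact (List.count_not_add_count w false).symm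

lemma runWord_mem_dyckSet {N k : ℕ} {L : List (ℕ × ℕ)} (hL : L ∈ dyckRuns N k) :
    runWord L ∈ DyckSet N k 0 := by
  obtain ⟨rfl, hpos, hu, hd, hpre⟩ := hL
  have hasc := ascentLengths_runWord L fun q hq => (hpos q hq).2
  have hge : ∀ x ∈ ascentLengths (runWord L), 2 ≤ x := by
    rw [hasc]
    simp only [List.mem_map]
    rintro x ⟨q, hq, rfl⟩
    have := (hpos q hq).1
    omega
  have ht := count_true_runWord L
  have hf := count_false_runWord L
  refine ⟨?_, by omega, fun p hp => ?_, ?_, ?_, fun j hj => ?_⟩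
  · rw [length_eq_count_true_add_count_false]
    omega
  · simpa using count_false_le_of_prefix_runWord L 0 (by simpa using hpre) p hp
  · rw [List.filter_eq_self.2 (by simpa using hge), hasc, List.length_map]
  · rw [List.length_eq_zero_iff, List.filter_eq_nil_iff]
    intro x hx
    have := hge x hx
    simp
    omega
  · by_cases hlt : j < (ascentLengths (runWord L)).length
    · rw [List.getD_eq_getElem _ _ hlt] at hj
      have := hge _ (List.getElem_mem hlt)
      omega
    · rw [List.getD_eq_default _ _ (by omega)] at hj
      omega

lemma exists_runWord_eq_of_mem_dyckSet {N k : ℕ} {w : List Bool} (hw : w ∈ DyckSet N k 0) :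
    ∃ L ∈ dyckRuns N k, runWord L = w := by
  obtain ⟨hlen, hbal, hpre, hlong, hsing, -⟩ := hw
  obtain ⟨m, L, hd, rfl⟩ := exists_eq_replicate_append_runWord w fun v hv => by
    have h1 := hpre v ⟨[true], hv.symm⟩
    rw [hv] at hbal
    simp [List.count_append] at hbal
    omega
  have hm : m = 0 := by
    have := hpre (List.replicate m false) (List.prefix_append _ _)
    simpa [List.count_replicate] using this
  subst hm
  simp only [List.replicate_zero, List.nil_append] at hlen hbal hpre hlong hsing ⊢
  have ht := count_true_runWord L
  have hf := count_false_runWord L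
  rw [ascentLengths_runWord L hd] at hlong hsing
  have hu : ∀ q ∈ L, 1 ≤ q.1 := by
    rw [List.length_eq_zero_iff, List.filter_eq_nil_iff] at hsing
    intro q hq
    have := hsing (q.1 + 1) (List.mem_map.2 ⟨q, hq, rfl⟩)
    simp at this
    omega
  have hk : L.length = k := by
    rw [List.filter_eq_self.2, List.length_map] at hlong
    · exact hlong
    · simp only [List.mem_map]
      rintro x ⟨q, hq, rfl⟩
      simpa using hu q hq
  rw [length_eq_count_true_add_count_false] at hlen
  refine ⟨L, ⟨hk, fun q hq => ⟨hu q hq, hd q hq⟩, by omega, by omega, fun j hj => ?_⟩, rfl⟩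
  have := hpre (runWord (L.take j)) (by
    conv_rhs => rw [← List.take_append_drop j L, runWord_append]
    exact List.prefix_append _ _)
  rw [count_true_runWord, count_false_runWord, List.length_take] at this
  simp only [← List.map_take]
  omega

lemma bijOn_runWord (N k : ℕ) : Set.BijOn runWord (dyckRuns N k) (DyckSet N k 0) := by
  refine ⟨fun L hL => runWord_mem_dyckSet hL, fun L hL M hM h => ?_, fun w hw =>
    exists_runWord_eq_of_mem_dyckSet hw⟩
  apply runs_injective
  rw [← splitBy_runWord L fun q hq => (hL.2.1 q hq).2, h,
    splitBy_runWord M fun q hq => (hM.2.1 q hq).2]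

/-! ## Partial sums -/

/-- Pairs of sequences `(r, p)`, with `r` increasing from `0` to `N - k` and `p` increasing from `0`
to `N` on `{0, …, k}`, constant afterwards, such that `p j ≤ r j + j`. -/
def ballotPairs (N k : ℕ) : Set (ℕ → ℕ × ℕ) :=
  {g | g 0 = (0, 0) ∧ (∀ j, k ≤ j → (g j).1 + k = N ∧ (g j).2 = N) ∧
    (∀ j < k, (g j).1 < (g (j + 1)).1 ∧ (g j).2 < (g (j + 1)).2) ∧
    ∀ j ≤ k, (g j).2 ≤ (g j).1 + j}

/-- The partial sums of both coordinates of a list of pairs. -/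
def partialSums (L : List (ℕ × ℕ)) (j : ℕ) : ℕ × ℕ :=
  (((L.map Prod.fst).take j).sum, ((L.map Prod.snd).take j).sum)

lemma partialSums_succ (L : List (ℕ × ℕ)) {j : ℕ} (hj : j < L.length) :
    partialSums L (j + 1) = partialSums L j + L[j] := by
  ext <;> simp [partialSums, List.sum_take_succ, hj]

/-- The list of the increments of `g` at `0, …, k - 1`. -/
def increments (k : ℕ) (g : ℕ → ℕ × ℕ) : List (ℕ × ℕ) :=
  (List.range k).map fun j => ((g (j + 1)).1 - (g j).1, (g (j + 1)).2 - (g j).2)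

lemma partialSums_increments {N k : ℕ} {g : ℕ → ℕ × ℕ} (hg : g ∈ ballotPairs N k) :
    partialSums (increments k g) = g := by
  obtain ⟨h0, hk, hlt, -⟩ := hg
  have key : ∀ j ≤ k, partialSums (increments k g) j = g j := by
    intro j
    induction j with
    | zero => intro _; rw [h0]; simp [partialSums]
    | succ j ih =>
      intro hj
      rw [partialSums_succ _ (by simpa [increments] using hj), ih (by omega)]
      have := hlt j (by omega)
      ext <;> simp [increments] <;> omega
  funext j
  rcases le_total j k with hj | hj
  · exact key j hj
  · have hle : (increments k g).length ≤ j := by simpa [increments] using hj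
    have e : partialSums (increments k g) j = partialSums (increments k g) k := by
      simp only [partialSums]
      rw [List.take_of_length_le (by simpa using hle), List.take_of_length_le (by simpa using hle),
        List.take_of_length_le (by simp [increments]), List.take_of_length_le (by simp [increments])]
    rw [e, key k le_rfl]
    have h1 := hk j hj
    have h2 := hk k le_rfl
    ext <;> omega

lemma bijOn_partialSums (N k : ℕ) :
    Set.BijOn partialSums (dyckRuns N k) (ballotPairs N k) := by
  refine ⟨?_, ?_, fun g hg => ⟨increments k g, ?_, partialSums_increments hg⟩⟩
  · rintro L ⟨rfl, hpos, hu, hd, hpre⟩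
    refine ⟨by simp [partialSums], fun j hj => ?_, fun j hj => ?_, hpre⟩
    · simp only [partialSums]
      rw [List.take_of_length_le (by simpa using hj), List.take_of_length_le (by simpa using hj)]
      exact ⟨hu, hd⟩
    · rw [partialSums_succ L hj]
      have := hpos _ (List.getElem_mem hj)
      simp only [Prod.fst_add, Prod.snd_add]
      omega
  · intro L hL M hM h
    have hlen : L.length = M.length := hL.1.trans hM.1.symm
    refine List.ext_getElem hlen fun j hj hj' => ?_
    have e := congrFun h (j + 1)
    rw [partialSums_succ L hj, partialSums_succ M hj', h] at e
    exact add_left_cancel e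
  · have hsum := partialSums_increments hg
    obtain ⟨h0, hk, hlt, hle⟩ := hg
    have hlen : (increments k g).length = k := by simp [increments]
    have htot := hk k le_rfl
    rw [← hsum] at htot hle
    simp only [partialSums] at htot
    rw [List.take_of_length_le (by simp [hlen]), List.take_of_length_le (by simp [hlen])] at htot
    refine ⟨hlen, ?_, htot.1, htot.2, hle⟩
    simp only [increments, List.mem_map, List.mem_range]
    rintro q ⟨j, hj, rfl⟩
    have := hlt j hj
    simp only
    omega

/-! ## Counting around finite sets -/

/-- `n` satisfies `P` and is not one of `y 0, …, y (k - 1)`. -/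
def Avoiding (P : ℕ → Prop) (y : ℕ → ℕ) (k n : ℕ) : Prop := P n ∧ ∀ c < k, y c ≠ n

instance (P : ℕ → Prop) [DecidablePred P] (y : ℕ → ℕ) (k : ℕ) :
    DecidablePred (Avoiding P y k) :=
  fun n => inferInstanceAs (Decidable (P n ∧ ∀ c < k, y c ≠ n))

lemma infinite_avoiding {P : ℕ → Prop} (hP : {n | P n}.Infinite) (y : ℕ → ℕ) (k : ℕ) :
    {n | Avoiding P y k n}.Infinite := by
  refine (hP.sdiff ((Set.finite_Iio k).image y)).mono ?_
  rintro n ⟨hn, hny⟩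
  exact ⟨hn, fun c hc h => hny ⟨c, hc, h⟩⟩

lemma count_avoiding {P : ℕ → Prop} [DecidablePred P] {y : ℕ → ℕ} {k : ℕ}
    (hy : Set.InjOn y (Set.Iio k)) (hP : ∀ c < k, P (y c)) (m : ℕ) :
    Nat.count (Avoiding P y k) m + ((Finset.range k).filter fun c => y c < m).card =
      Nat.count P m := by
  have e : (Finset.range m).filter P = (Finset.range m).filter (Avoiding P y k) ∪
      ((Finset.range k).filter fun c => y c < m).image y := by
    ext n
    simp only [Avoiding, Finset.mem_union, Finset.mem_filter, Finset.mem_range, Finset.mem_image]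
    constructor
    · rintro ⟨h1, h2⟩
      by_cases h : ∃ c < k, y c = n
      · obtain ⟨c, hc, rfl⟩ := h
        exact Or.inr ⟨c, ⟨hc, h1⟩, rfl⟩
      · push Not at h
        exact Or.inl ⟨h1, h2, h⟩
    · rintro (⟨h1, h2, -⟩ | ⟨c, ⟨hc, h⟩, rfl⟩)
      · exact ⟨h1, h2⟩
      · exact ⟨h, hP c hc⟩
  rw [Nat.count_eq_card_filter_range, Nat.count_eq_card_filter_range, e,
    Finset.card_union_of_disjoint, Finset.card_image_of_injOn]
  · exact hy.mono fun c hc => by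
      simp only [Finset.coe_filter, Finset.mem_range, Set.mem_ofPred_eq] at hc
      exact hc.1
  · rw [Finset.disjoint_left]
    simp only [Avoiding, Finset.mem_filter, Finset.mem_range, Finset.mem_image]
    rintro n ⟨-, -, h⟩ ⟨c, ⟨hc, -⟩, rfl⟩
    exact h c hc rfl

lemma count_avoiding_of_forall_lt {P : ℕ → Prop} [DecidablePred P] {y : ℕ → ℕ} {k m : ℕ}
    (hy : Set.InjOn y (Set.Iio k)) (hP : ∀ c < k, P (y c)) (hm : ∀ c < k, y c < m) :
    Nat.count (Avoiding P y k) m + k = Nat.count P m := by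
  rw [← count_avoiding hy hP m, Finset.filter_true_of_mem (by simpa using hm), Finset.card_range]

lemma count_avoiding_true_apply {x : ℕ → ℕ} {k j : ℕ} (hx : StrictMonoOn x (Set.Iio k))
    (hj : j < k) : Nat.count (Avoiding (fun _ => True) x k) (x j) + j = x j := by
  have h := count_avoiding (P := fun _ => True) hx.injOn (fun _ _ => trivial) (x j)
  have e : ((Finset.range k).filter fun c => x c < x j) = Finset.range j := by
    ext c
    simp only [Finset.mem_filter, Finset.mem_range]
    constructor
    · rintro ⟨hc, h⟩
      exact (hx.lt_iff_lt hc hj).1 h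
    · intro hc
      exact ⟨hc.trans hj, hx (hc.trans hj) hj hc⟩
  rwa [e, Finset.card_range, Nat.count_true] at h

lemma count_apply_of_forall_iff {Q : ℕ → Prop} [DecidablePred Q] {z : ℕ → ℕ} {m r : ℕ}
    (hz : StrictMonoOn z (Set.Iio m)) (hr : r < m)
    (hQ : ∀ n ≤ z r, Q n ↔ ∃ s < m, z s = n) : Nat.count Q (z r) = r := by
  have e : (Finset.range (z r)).filter Q = (Finset.range r).image z := by
    ext n
    simp only [Finset.mem_filter, Finset.mem_range, Finset.mem_image]
    constructor
    · rintro ⟨hn, h⟩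
      obtain ⟨s, hs, rfl⟩ := (hQ n hn.le).1 h
      exact ⟨s, (hz.lt_iff_lt hs hr).1 hn, rfl⟩
    · rintro ⟨s, hs, rfl⟩
      have h := hz (hs.trans hr) hr hs
      exact ⟨h, (hQ _ h.le).2 ⟨s, hs.trans hr, rfl⟩⟩
  rw [Nat.count_eq_card_filter_range, e, Finset.card_image_of_injOn, Finset.card_range]
  exact hz.injOn.mono fun s hs => (by simpa using hs : s < r).trans hr

lemma count_congr_of_forall {P Q : ℕ → Prop} [DecidablePred P] [DecidablePred Q]
    (h : ∀ n, P n ↔ Q n) (m : ℕ) : Nat.count P m = Nat.count Q m :=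
  le_antisymm (Nat.count_mono_left fun n _ => (h n).1) (Nat.count_mono_left fun n _ => (h n).2)

lemma avoiding_congr {P P' : ℕ → Prop} {y y' : ℕ → ℕ} {k : ℕ} (hP : ∀ n, P n ↔ P' n)
    (hy : ∀ c < k, y c = y' c) (n : ℕ) : Avoiding P y k n ↔ Avoiding P' y' k n :=
  and_congr (hP n) (forall₂_congr fun c hc => by rw [hy c hc])

/-! ## Tableaux as triples of sequences -/

/-- The sequences `x`, `y`, `z` are the first row, the second row and the rest of the first column
of a standard filling by `0, …, N - 1` of the shape with two rows of length `k` and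
`m` further rows of length one. -/
structure IsFilling (k m N : ℕ) (x y z : ℕ → ℕ) : Prop where
  x_mono : StrictMonoOn x (Set.Iio k)
  y_mono : StrictMonoOn y (Set.Iio k)
  z_mono : StrictMonoOn z (Set.Iio m)
  x_lt_y : ∀ c < k, x c < y c
  y_lt_z : ∀ s < m, y 0 < z s
  x_lt : ∀ c < k, x c < N
  y_lt : ∀ c < k, y c < N
  z_lt : ∀ s < m, z s < N
  x_ne_y : ∀ c < k, ∀ d < k, x c ≠ y d
  x_ne_z : ∀ c < k, ∀ s < m, x c ≠ z s
  y_ne_z : ∀ c < k, ∀ s < m, y c ≠ z s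
  cover : ∀ n < N, (∃ c < k, x c = n) ∨ (∃ c < k, y c = n) ∨ ∃ s < m, z s = n

/-- For `j < k`, the number of elements below `y j` outside the first row `x`, paired with `x j`. -/
def fillingStat (k N : ℕ) (x y : ℕ → ℕ) (j : ℕ) : ℕ × ℕ :=
  if j < k then (Nat.count (Avoiding (fun _ => True) x k) (y j), x j) else (N - k, N)

namespace IsFilling

variable {k m N : ℕ} {x y z : ℕ → ℕ}

lemma avoiding_x_y (h : IsFilling k m N x y z) {c : ℕ} (hc : c < k) :
    Avoiding (fun _ => True) x k (y c) :=
  ⟨trivial, fun d hd => h.x_ne_y d hd c hc⟩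

lemma le_of_avoiding_x (h : IsFilling k m N x y z) {n : ℕ} (hn : n < N)
    (hx : Avoiding (fun _ => True) x k n) : y 0 ≤ n := by
  rcases h.cover n hn with ⟨c, hc, rfl⟩ | ⟨c, hc, rfl⟩ | ⟨s, hs, rfl⟩
  · exact absurd rfl (hx.2 c hc)
  · exact h.y_mono.monotoneOn (Nat.zero_lt_of_lt hc) hc (Nat.zero_le c)
  · exact (h.y_lt_z s hs).le

lemma count_avoiding_z (h : IsFilling k m N x y z) {s : ℕ} (hs : s < m) :
    Nat.count (Avoiding (Avoiding (fun _ => True) x k) y k) (z s) = s := by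
  refine count_apply_of_forall_iff h.z_mono hs fun n hn => ⟨fun hQ => ?_, ?_⟩
  · rcases h.cover n (hn.trans_lt (h.z_lt s hs)) with ⟨c, hc, e⟩ | ⟨c, hc, e⟩ | hz
    · exact absurd e (hQ.1.2 c hc)
    · exact absurd e (hQ.2 c hc)
    · exact hz
  · rintro ⟨t, ht, rfl⟩
    exact ⟨⟨trivial, fun c hc => h.x_ne_z c hc t ht⟩, fun c hc => h.y_ne_z c hc t ht⟩

lemma fillingStat_mem (h : IsFilling k m N x y z) (hk : 1 ≤ k) (hkN : k ≤ N) :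
    fillingStat k N x y ∈ ballotPairs N k := by
  have hcN : Nat.count (Avoiding (fun _ => True) x k) N + k = N := by
    simpa using count_avoiding_of_forall_lt (P := fun _ => True) h.x_mono.injOn
      (fun _ _ => trivial) h.x_lt
  refine ⟨?_, fun j hj => ?_, fun j hj => ?_, fun j hj => ?_⟩
  · have hx0 : x 0 = 0 := by
      rcases h.cover 0 (by omega) with ⟨c, hc, e⟩ | ⟨c, hc, e⟩ | ⟨s, hs, e⟩
      · have := h.x_mono.monotoneOn (Nat.zero_lt_of_lt hc) hc (Nat.zero_le c)
        omega
      · have := h.x_lt_y c hc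
        omega
      · have := h.y_lt_z s hs
        omega
    have hy0 : Nat.count (Avoiding (fun _ => True) x k) (y 0) = 0 :=
      Nat.count_iff_forall_not.2 fun n hn hx =>
        hn.not_ge (h.le_of_avoiding_x (hn.trans (h.y_lt 0 hk)) hx)
    rw [fillingStat, if_pos (by omega), hx0, hy0]
  · rw [fillingStat, if_neg (by omega)]
    exact ⟨by simp; omega, rfl⟩
  · rw [fillingStat, if_pos hj, fillingStat]
    split_ifs with hj'
    · exact ⟨Nat.count_strict_mono (h.avoiding_x_y hj) (h.y_mono hj hj' (Nat.lt_succ_self j)),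
        h.x_mono hj hj' (Nat.lt_succ_self j)⟩
    · have := Nat.count_strict_mono (h.avoiding_x_y hj) (h.y_lt j hj)
      exact ⟨by simp; omega, h.x_lt j hj⟩
  · rw [fillingStat]
    split_ifs with hj'
    · have h1 := count_avoiding_true_apply h.x_mono hj'
      have h2 := Nat.count_monotone (Avoiding (fun _ => True) x k) (h.x_lt_y j hj').le
      simp only
      omega
    · simp only
      omega

lemma eq_of_fillingStat_eq {x' y' z' : ℕ → ℕ} (h : IsFilling k m N x y z)
    (h' : IsFilling k m N x' y' z') (e : fillingStat k N x y = fillingStat k N x' y') :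
    (∀ c < k, x c = x' c) ∧ (∀ c < k, y c = y' c) ∧ ∀ s < m, z s = z' s := by
  have hx : ∀ c < k, x c = x' c := fun c hc => by
    simpa [fillingStat, hc] using congrArg Prod.snd (congrFun e c)
  have hP := avoiding_congr (P := fun _ => True) (fun _ => Iff.rfl) hx
  have hy : ∀ c < k, y c = y' c := fun c hc => by
    have hc' := congrArg Prod.fst (congrFun e c)
    simp only [fillingStat, if_pos hc] at hc'
    rw [← count_congr_of_forall hP] at hc'
    exact Nat.count_injective (h.avoiding_x_y hc) ((hP _).2 (h'.avoiding_x_y hc)) hc'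
  refine ⟨hx, hy, fun s hs => ?_⟩
  have hQ := avoiding_congr hP hy
  have hc := (h.count_avoiding_z hs).trans (h'.count_avoiding_z hs).symm
  rw [← count_congr_of_forall hQ] at hc
  refine Nat.count_injective ?_ ((hQ _).2 ?_) hc
  · exact ⟨⟨trivial, fun c hc => h.x_ne_z c hc s hs⟩, fun c hc => h.y_ne_z c hc s hs⟩
  · exact ⟨⟨trivial, fun c hc => h'.x_ne_z c hc s hs⟩, fun c hc => h'.y_ne_z c hc s hs⟩

end IsFilling

lemma exists_isFilling_of_mem_ballotPairs {k m N : ℕ} (hk : 1 ≤ k) (hN : N = m + 2 * k)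
    {g : ℕ → ℕ × ℕ} (hg : g ∈ ballotPairs N k) :
    ∃ x y z, IsFilling k m N x y z ∧ fillingStat k N x y = g := by
  obtain ⟨h0, hend, hlt, hle⟩ := hg
  have hmono : StrictMonoOn (fun j => (g j).1) (Set.Iic k) ∧
      StrictMonoOn (fun j => (g j).2) (Set.Iic k) :=
    ⟨strictMonoOn_of_lt_add_one Set.ordConnected_Iic fun j _ _ hj => (hlt j hj).1,
      strictMonoOn_of_lt_add_one Set.ordConnected_Iic fun j _ _ hj => (hlt j hj).2⟩
  obtain ⟨hr, hx⟩ := hmono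
  have hsub : Set.Iio k ⊆ Set.Iic k := Set.Iio_subset_Iic_self
  have hend' := hend k le_rfl
  set x : ℕ → ℕ := fun j => (g j).2 with hx_def
  set r : ℕ → ℕ := fun j => (g j).1 with hr_def
  set P := Avoiding (fun _ => True) x k with hP_def
  have hPinf : {n | P n}.Infinite :=
    infinite_avoiding (by simpa using Set.infinite_univ) x k
  set y : ℕ → ℕ := fun j => Nat.nth P (r j) with hy_def
  have hPy : ∀ j, P (y j) := fun j => Nat.nth_mem_of_infinite hPinf _
  have hcy : ∀ j, Nat.count P (y j) = r j := fun j => Nat.count_nth_of_infinite hPinf _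
  set Q := Avoiding P y k with hQ_def
  have hQinf : {n | Q n}.Infinite := infinite_avoiding hPinf y k
  set z : ℕ → ℕ := Nat.nth Q with hz_def
  have hQz : ∀ s, Q (z s) := Nat.nth_mem_of_infinite hQinf
  have hxk : StrictMonoOn x (Set.Iio k) := hx.mono hsub
  have hyk : StrictMonoOn y (Set.Iio k) := fun c hc d hd hcd =>
    Nat.nth_strictMono hPinf (hr (hsub hc) (hsub hd) hcd)
  have hxN : ∀ c < k, x c < N := fun c hc => by
    have : x c < x k := hx (hsub hc) (Set.mem_Iic.2 le_rfl) hc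
    exact this.trans_eq hend'.2
  have hcP : Nat.count P N + k = N := by
    simpa using count_avoiding_of_forall_lt (P := fun _ => True) hxk.injOn
      (fun _ _ => trivial) hxN
  have hyN : ∀ c < k, y c < N := fun c hc => by
    have h1 : r c < r k := hr (hsub hc) (Set.mem_Iic.2 le_rfl) hc
    have h2 : r k + k = N := hend'.1
    exact Nat.nth_lt_of_lt_count (by omega)
  have hcQ : Nat.count Q N + k = Nat.count P N :=
    count_avoiding_of_forall_lt hyk.injOn (fun c _ => hPy c) hyN
  refine ⟨x, y, z, ⟨hxk, hyk, (Nat.nth_strictMono hQinf).strictMonoOn _, fun c hc => ?_,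
    fun s _ => ?_, hxN, hyN, fun s hs => Nat.nth_lt_of_lt_count (by omega),
    fun c hc d _ => (hPy d).2 c hc, fun c hc s _ => (hQz s).1.2 c hc,
    fun c hc s _ => (hQz s).2 c hc, fun n hn => ?_⟩, ?_⟩
  · by_contra! hcon
    have hne := (hPy c).2 c hc
    have h1 := Nat.count_strict_mono (hPy c) (lt_of_le_of_ne hcon hne.symm)
    have h2 : Nat.count P (x c) + c = x c := count_avoiding_true_apply hxk hc
    have h3 : x c ≤ r c + c := hle c hc.le
    rw [hcy] at h1
    omega
  · refine lt_of_le_of_ne ?_ ((hQz s).2 0 hk)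
    rw [← Nat.nth_count (hQz s).1]
    refine Nat.nth_monotone hPinf ?_
    simp [hr_def, h0]
  · by_cases hPn : P n
    · by_cases hQn : Q n
      · exact Or.inr (Or.inr ⟨Nat.count Q n, by
          have := Nat.count_strict_mono hQn hn
          omega, Nat.nth_count hQn⟩)
      · right; left
        by_contra! hcon
        exact hQn ⟨hPn, hcon⟩
    · left
      by_contra! hcon
      exact hPn ⟨trivial, hcon⟩
  · funext j
    rw [fillingStat]
    split_ifs with hj
    · exact Prod.ext (hcy j) rfl
    · have := hend j (by omega)
      exact Prod.ext (by simp; omega) this.2.symm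

/-! ## Tableaux as fillings -/

lemma mem_skytCells_two {a i r c : ℕ} :
    (r, c) ∈ skytCells a i 2 ↔ r < a ∧ c ≤ i ∧ (2 ≤ r → c = 0) := by
  simp only [skytCells, Finset.mem_filter, Finset.mem_product, Finset.mem_range]
  omega

/-- The entry of `f` in row `r` and column `c`, decreased by one. -/
def entry (f : ℕ × ℕ → ℕ) (r c : ℕ) : ℕ := f (r, c) - 1

lemma isFilling_of_mem_skytSet {a i : ℕ} {f : ℕ × ℕ → ℕ} (ha : 2 ≤ a) (hf : f ∈ SkytSet a i 2) :
    (∀ c ∈ skytCells a i 2, 1 ≤ f c) ∧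
      IsFilling (i + 1) (a - 2) (a + 2 * i) (entry f 0) (entry f 1)
        fun s => entry f (s + 2) 0 := by
  obtain ⟨-, ⟨hmaps, hinj, hsurj⟩, hrow, hcol⟩ := hf
  have hmem : ∀ c ∈ skytCells a i 2, 1 ≤ f c ∧ f c ≤ a + 2 * i := fun c hc => by
    have := hmaps hc
    simp only [Finset.coe_Icc, Set.mem_Icc] at this
    omega
  have c0 : ∀ c < i + 1, (0, c) ∈ skytCells a i 2 := fun c hc => mem_skytCells_two.2 (by omega)
  have c1 : ∀ c < i + 1, (1, c) ∈ skytCells a i 2 := fun c hc => mem_skytCells_two.2 (by omega)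
  have c2 : ∀ s < a - 2, (s + 2, 0) ∈ skytCells a i 2 :=
    fun s hs => mem_skytCells_two.2 (by omega)
  have hne : ∀ c ∈ skytCells a i 2, ∀ d ∈ skytCells a i 2, c.1 ≠ d.1 →
      f c - 1 ≠ f d - 1 := fun c hc d hd hcd h => by
    have h1 := hmem c hc
    have h2 := hmem d hd
    exact hcd (congrArg Prod.fst (hinj hc hd (by omega)))
  refine ⟨fun c hc => (hmem c hc).1, ?_⟩
  constructor
  · intro c hc d hd hcd
    have := hrow _ (c0 c hc) _ (c0 d hd) rfl hcd
    have := hmem _ (c0 c hc)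
    simp only [entry]
    omega
  · intro c hc d hd hcd
    have := hrow _ (c1 c hc) _ (c1 d hd) rfl hcd
    have := hmem _ (c1 c hc)
    simp only [entry]
    omega
  · intro c hc d hd hcd
    have := hcol _ (c2 c hc) _ (c2 d hd) rfl (Nat.add_lt_add_right hcd 2)
    have := hmem _ (c2 c hc)
    simp only [entry]
    omega
  · intro c hc
    have := hcol _ (c0 c hc) _ (c1 c hc) rfl Nat.zero_lt_one
    have := hmem _ (c0 c hc)
    simp only [entry]
    omega
  · intro s hs
    have := hcol _ (c1 0 (Nat.succ_pos i)) _ (c2 s hs) rfl (by simp)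
    have := hmem _ (c1 0 (Nat.succ_pos i))
    simp only [entry]
    omega
  · intro c hc
    have := hmem _ (c0 c hc)
    simp only [entry]
    omega
  · intro c hc
    have := hmem _ (c1 c hc)
    simp only [entry]
    omega
  · intro s hs
    have := hmem _ (c2 s hs)
    simp only [entry]
    omega
  · exact fun c hc d hd => hne _ (c0 c hc) _ (c1 d hd) (by simp)
  · exact fun c hc s hs => hne _ (c0 c hc) _ (c2 s hs) (by simp)
  · exact fun c hc s hs => hne _ (c1 c hc) _ (c2 s hs) (by simp)
  · intro n hn
    obtain ⟨⟨r, c⟩, hc, e⟩ := hsurj (show n + 1 ∈ _ by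
      simp only [Finset.coe_Icc, Set.mem_Icc]
      omega)
    obtain ⟨hr, hci, hrc⟩ := mem_skytCells_two.1 hc
    rcases r with _ | _ | r
    · exact Or.inl ⟨c, by omega, by simp [entry, e]⟩
    · exact Or.inr (Or.inl ⟨c, by omega, by simp only [entry, e]; omega⟩)
    · obtain rfl := hrc (by omega)
      exact Or.inr (Or.inr ⟨r, by omega, by simp only [entry, e]; omega⟩)

/-- The tableau with first row `x`, second row `y` and the rest of the first column `z`,
with entries increased by one. -/
def tableauOf (a i : ℕ) (x y z : ℕ → ℕ) : ℕ × ℕ → ℕ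
  | (0, c) => if c ≤ i then x c + 1 else 0
  | (1, c) => if c ≤ i then y c + 1 else 0
  | (s + 2, c) => if c = 0 ∧ s + 2 < a then z s + 1 else 0

lemma tableauOf_mem_skytSet {a i : ℕ} {x y z : ℕ → ℕ} (ha : 2 ≤ a)
    (h : IsFilling (i + 1) (a - 2) (a + 2 * i) x y z) : tableauOf a i x y z ∈ SkytSet a i 2 := by
  have hy0 : ∀ s < a - 2, x 0 < z s ∧ y 0 < z s := fun s hs =>
    ⟨(h.x_lt_y 0 (Nat.succ_pos i)).trans (h.y_lt_z s hs), h.y_lt_z s hs⟩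
  refine ⟨?_, ⟨?_, ?_, ?_⟩, ?_, ?_⟩
  · rintro ⟨_ | _ | s, c⟩ hc <;> rw [mem_skytCells_two] at hc <;>
      simp only [tableauOf, ite_eq_right_iff] <;> omega
  · rintro ⟨_ | _ | s, c⟩ hc <;> rw [Finset.mem_coe, mem_skytCells_two] at hc <;>
      simp only [tableauOf, Finset.coe_Icc, Set.mem_Icc]
    · have := h.x_lt c (by omega)
      rw [if_pos (by omega)]
      omega
    · have := h.y_lt c (by omega)
      rw [if_pos (by omega)]
      omega
    · have := h.z_lt s (by omega)
      rw [if_pos (by omega)]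
      omega
  · rintro ⟨_ | _ | s, c⟩ hc ⟨_ | _ | t, d⟩ hd e <;>
      rw [Finset.mem_coe, mem_skytCells_two] at hc hd <;>
      simp only [tableauOf] at e <;>
      rw [if_pos (by omega), if_pos (by omega), Nat.add_right_cancel_iff] at e
    · rw [h.x_mono.injOn (Set.mem_Iio.2 (by omega)) (Set.mem_Iio.2 (by omega)) e]
    · exact absurd e (h.x_ne_y c (by omega) d (by omega))
    · exact absurd e (h.x_ne_z c (by omega) t (by omega))
    · exact absurd e.symm (h.x_ne_y d (by omega) c (by omega))
    · rw [h.y_mono.injOn (Set.mem_Iio.2 (by omega)) (Set.mem_Iio.2 (by omega)) e]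
    · exact absurd e (h.y_ne_z c (by omega) t (by omega))
    · exact absurd e.symm (h.x_ne_z d (by omega) s (by omega))
    · exact absurd e.symm (h.y_ne_z d (by omega) s (by omega))
    · rw [h.z_mono.injOn (Set.mem_Iio.2 (by omega)) (Set.mem_Iio.2 (by omega)) e,
        hc.2.2 (by omega), hd.2.2 (by omega)]
  · intro n hn
    simp only [Finset.coe_Icc, Set.mem_Icc] at hn
    obtain ⟨n, rfl⟩ : ∃ l, n = l + 1 := ⟨n - 1, by omega⟩
    rcases h.cover n (by omega) with ⟨c, hc, rfl⟩ | ⟨c, hc, rfl⟩ | ⟨s, hs, rfl⟩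
    · exact ⟨(0, c), mem_skytCells_two.2 (by omega), if_pos (by omega)⟩
    · exact ⟨(1, c), mem_skytCells_two.2 (by omega), if_pos (by omega)⟩
    · exact ⟨(s + 2, 0), mem_skytCells_two.2 (by omega), if_pos (by omega)⟩
  · rintro ⟨_ | _ | s, c⟩ hc ⟨r, d⟩ hd rfl hcd <;> rw [mem_skytCells_two] at hc hd <;>
      simp only at hcd
    · have := h.x_mono (Set.mem_Iio.2 (by omega)) (Set.mem_Iio.2 (by omega)) hcd
      simp only [tableauOf]
      rw [if_pos (by omega), if_pos (by omega)]
      omega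
    · have := h.y_mono (Set.mem_Iio.2 (by omega)) (Set.mem_Iio.2 (by omega)) hcd
      simp only [tableauOf]
      rw [if_pos (by omega), if_pos (by omega)]
      omega
    · omega
  · rintro ⟨_ | _ | s, c⟩ hc ⟨_ | _ | t, d⟩ hd rfl hcd <;> rw [mem_skytCells_two] at hc hd <;>
      simp only at hcd <;> try omega
    · have := h.x_lt_y c (by omega)
      simp only [tableauOf]
      rw [if_pos (by omega), if_pos (by omega)]
      omega
    · obtain rfl : c = 0 := hd.2.2 (by omega)
      have := hy0 t (by omega)
      simp only [tableauOf]
      rw [if_pos (by omega), if_pos ⟨trivial, by omega⟩]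
      omega
    · obtain rfl : c = 0 := hd.2.2 (by omega)
      have := hy0 t (by omega)
      simp only [tableauOf]
      rw [if_pos (by omega), if_pos ⟨trivial, by omega⟩]
      omega
    · have := h.z_mono (a := s) (b := t) (Set.mem_Iio.2 (by omega)) (Set.mem_Iio.2 (by omega))
        (by omega)
      simp only [tableauOf]
      rw [if_pos (by omega), if_pos (by omega)]
      omega

/-- The pair of sequences attached to the first two rows of a tableau. -/
def tableauStat (a i : ℕ) (f : ℕ × ℕ → ℕ) : ℕ → ℕ × ℕ :=
  fillingStat (i + 1) (a + 2 * i) (entry f 0) (entry f 1)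

lemma fillingStat_congr {k N : ℕ} {x y x' y' : ℕ → ℕ} (hx : ∀ c < k, x c = x' c)
    (hy : ∀ c < k, y c = y' c) : fillingStat k N x y = fillingStat k N x' y' := by
  funext j
  simp only [fillingStat]
  split_ifs with hj
  · rw [hx j hj, hy j hj, count_congr_of_forall (avoiding_congr (fun _ => Iff.rfl) hx)]
  · rfl

lemma bijOn_tableauStat {a i : ℕ} (ha : 2 ≤ a) :
    Set.BijOn (tableauStat a i) (SkytSet a i 2) (ballotPairs (a + 2 * i) (i + 1)) := by
  refine ⟨fun f hf => (isFilling_of_mem_skytSet ha hf).2.fillingStat_mem (by omega) (by omega),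
    fun f hf g hg e => ?_, fun p hp => ?_⟩
  · obtain ⟨hf1, hf2⟩ := isFilling_of_mem_skytSet ha hf
    obtain ⟨hg1, hg2⟩ := isFilling_of_mem_skytSet ha hg
    obtain ⟨hx, hy, hz⟩ := hf2.eq_of_fillingStat_eq hg2 e
    funext c
    by_cases hc : c ∈ skytCells a i 2
    · have h1 := hf1 c hc
      have h2 := hg1 c hc
      suffices f c - 1 = g c - 1 by omega
      obtain ⟨_ | _ | s, c⟩ := c
      · exact hx c (by have := mem_skytCells_two.1 hc; omega)
      · exact hy c (by have := mem_skytCells_two.1 hc; omega)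
      · obtain ⟨hs, -, hc0⟩ := mem_skytCells_two.1 hc
        obtain rfl := hc0 (by omega)
        exact hz s (by omega)
    · rw [hf.1 c hc, hg.1 c hc]
  · obtain ⟨x, y, z, h, rfl⟩ :=
      exists_isFilling_of_mem_ballotPairs (m := a - 2) (by omega) (by omega) hp
    refine ⟨tableauOf a i x y z, tableauOf_mem_skytSet ha h, fillingStat_congr ?_ ?_⟩ <;>
    · intro c hc
      simp [entry, tableauOf, Nat.le_of_lt_succ hc]

/-- For all integers `a ≥ 2` and `i ≥ 1`, `Skyt(a,i,2)` is in bijection with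
`Dyck(a+2i, i+1, 0)`. -/
theorem skyt_equiv_dyck_b_two (a i : ℕ) (ha : 2 ≤ a) (hi : 1 ≤ i) :
    Nonempty (↥(SkytSet a i 2) ≃ ↥(DyckSet (a + 2 * i) (i + 1) 0)) := by
  exact ⟨((bijOn_tableauStat ha).equiv _).trans
    (((bijOn_partialSums _ _).equiv _).symm.trans ((bijOn_runWord _ _).equiv _))⟩
end

section
/- For all integers n and i with 1 ≤ i ≤ n−1, the set Dis(n+2,i) of dissections of an (n+2)-gon with i chords and the set Dyck(n+i+1, i+1, 0) of Dyck paths have the same cardinality. -/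
/-- `Builds N L p S V`: reading the arities in `L` from right to left, starting from the edge
`{N, N + 1}` of a polygon, produces the noncrossing set of chords `S` on the vertices
`p, …, N + 1`; the vertices other than `p` that lie below no chord are listed in `V`.
An arity `0` adds an edge, an arity `c ≥ 2` joins `p` to the `c`-th vertex of `V`. -/
inductive Builds (N : ℕ) : List ℕ → ℕ → Finset (ℕ × ℕ) → List ℕ → Prop
  | nil : Builds N [] N ∅ [N + 1]
  | leaf {L : List ℕ} {p : ℕ} {S : Finset (ℕ × ℕ)} {V : List ℕ} :
      Builds N L (p + 1) S V → Builds N (0 :: L) p S ((p + 1) :: V)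
  | node {L : List ℕ} {p q : ℕ} {S : Finset (ℕ × ℕ)} {V₁ V₂ : List ℕ} :
      Builds N L p S (V₁ ++ q :: V₂) → V₁ ≠ [] →
      Builds N ((V₁.length + 1) :: L) p (insert (p, q) S) (q :: V₂)

namespace Builds

variable {N p : ℕ} {L : List ℕ} {S : Finset (ℕ × ℕ)} {V : List ℕ}

theorem vertices (h : Builds N L p S V) :
    p ≤ N ∧ (∀ c ∈ S, p ≤ c.1 ∧ c.1 + 1 < c.2 ∧ c.2 ≤ N + 1) ∧ V.Pairwise (· < ·) ∧
      ∀ x, x ∈ V ↔ p < x ∧ x ≤ N + 1 ∧ ∀ c ∈ S, ¬(c.1 < x ∧ x < c.2) := by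
  induction h with
  | nil => 
    refine ⟨le_rfl, by simp, by simp, fun x => ?_⟩
    simp; omega
  | @leaf L p S V h ih =>
    obtain ⟨h1, h2, h3, h4⟩ := ih
    refine ⟨by omega, fun c hc => ⟨by have := h2 c hc; omega, (h2 c hc).2⟩, ?_, fun x => ?_⟩
    · rw [List.pairwise_cons]
      exact ⟨fun a ha => ((h4 a).1 ha).1, h3⟩
    · rw [List.mem_cons, h4]
      constructor
      · rintro (rfl | ⟨ha, hb, hc⟩)
        · exact ⟨by omega, by omega, fun c hc => by have := h2 c hc; omega⟩
        · exact ⟨by omega, hb, hc⟩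
      · rintro ⟨ha, hb, hc⟩
        by_cases hx : x = p + 1
        · exact Or.inl hx
        · exact Or.inr ⟨by omega, hb, hc⟩
  | @node L p q S V₁ V₂ h hV ih =>
    obtain ⟨h1, h2, h3, h4⟩ := ih
    obtain ⟨y, hy⟩ := List.exists_mem_of_ne_nil _ hV
    have hq := (h4 q).1 (by simp)
    have hyp := (h4 y).1 (by simp [hy])
    rw [List.pairwise_append, List.pairwise_cons] at h3
    obtain ⟨-, ⟨h5, h6⟩, h7⟩ := h3
    have hyq := h7 y hy q (by simp)
    refine ⟨h1, ?_, List.pairwise_cons.2 ⟨h5, h6⟩, fun x => ?_⟩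
    · intro c hc
      rcases Finset.mem_insert.1 hc with rfl | hc
      · exact ⟨le_rfl, by simp; omega, hq.2.1⟩
      · exact h2 c hc
    · have hx := h4 x
      rw [List.mem_append] at hx
      rw [Finset.forall_mem_insert]
      constructor
      · intro hm
        obtain ⟨ha, hb, hc⟩ := hx.1 (Or.inr hm)
        refine ⟨ha, hb, ?_, hc⟩
        rcases List.mem_cons.1 hm with rfl | hm
        · simp
        · have := h5 x hm
          simp; omega
      · rintro ⟨ha, hb, hd, hc⟩
        rcases hx.2 ⟨ha, hb, hc⟩ with hm | hm
        · exact absurd ⟨ha, h7 x hm q (by simp)⟩ hd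
        · exact hm

theorem noncrossing (h : Builds N L p S V) :
    ∀ c ∈ S, ∀ d ∈ S, ¬(c.1 < d.1 ∧ d.1 < c.2 ∧ c.2 < d.2) := by
  induction h with
  | nil => simp
  | leaf _ ih => exact ih
  | @node L p q S V₁ V₂ h hV ih =>
    obtain ⟨-, h2, -, h4⟩ := h.vertices
    have hq := (h4 q).1 (by simp)
    intro c hc d hd
    rcases Finset.mem_insert.1 hc with rfl | hc <;> rcases Finset.mem_insert.1 hd with rfl | hd
    · simp
    · exact fun hh => hq.2.2 d hd hh.2
    · have := h2 c hc
      simp; omega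
    · exact ih c hc d hd

theorem head_spec (h : Builds N L p S V) :
    ∃ x W, V = x :: W ∧ (x = p + 1 ∨ (p, x) ∈ S) ∧ ∀ b, (p, b) ∈ S → b ≤ x := by
  induction h with
  | nil => simp
  | @leaf L p S V h ih =>
    refine ⟨_, _, rfl, Or.inl rfl, fun b hb => ?_⟩
    have := h.vertices.2.1 _ hb
    simp at this
  | @node L p q S V₁ V₂ h hV ih =>
    refine ⟨_, _, rfl, Or.inr (by simp), fun b hb => ?_⟩
    obtain ⟨-, h2, -, h4⟩ := h.vertices
    have hq := (h4 q).1 (by simp)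
    rcases Finset.mem_insert.1 hb with hb | hb
    · simp at hb; omega
    · have := hq.2.2 _ hb
      simp at this; omega

theorem notMem {q : ℕ} {V₁ V₂ : List ℕ} (h : Builds N L p S (V₁ ++ q :: V₂)) (hV : V₁ ≠ []) :
    (p, q) ∉ S := by
  obtain ⟨-, -, h3, -⟩ := h.vertices
  obtain ⟨x, W, hW, -, hx⟩ := h.head_spec
  intro hq
  have hle := hx q hq
  obtain ⟨y, V₁, rfl⟩ := List.exists_cons_of_ne_nil hV
  simp at hW
  rw [List.pairwise_append] at h3
  have := h3.2.2 y (by simp) q (by simp)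
  omega

theorem counts (h : Builds N L p S V) :
    p + L.count 0 = N ∧ S.card + L.count 0 = L.length ∧ V.length + L.sum = L.length + 1 ∧
      1 ∉ L := by
  induction h with
  | nil => simp
  | leaf _ ih => 
    simp at *
    refine ⟨by omega, by omega, by omega, ih.2.2.2⟩
  | @node L p q S V₁ V₂ h hV ih =>
    have := List.length_pos_of_ne_nil hV
    have hq := h.notMem hV
    rw [Finset.card_insert_of_notMem hq]
    simp at *
    refine ⟨by omega, by omega, by omega, ⟨?_, ih.2.2.2⟩⟩
    exact fun hh => by simp [hh] at this

theorem suffix_sum_le (h : Builds N L p S V) : ∀ M, M <:+ L → M.sum ≤ M.length := by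
  induction h with
  | nil => simp
  | @leaf L p S V h ih =>
    intro M hM
    rcases List.suffix_cons_iff.1 hM with rfl | hM
    · have := h.counts.2.2.1
      obtain ⟨x, W, rfl, -⟩ := h.head_spec
      simp at *; omega
    · exact ih M hM
  | @node L p q S V₁ V₂ h hV ih =>
    intro M hM
    rcases List.suffix_cons_iff.1 hM with rfl | hM
    · have := h.counts.2.2.1
      simp at *; omega
    · exact ih M hM

theorem exists_of_list (hL : ∀ M, M <:+ L → M.sum ≤ M.length) (h1 : 1 ∉ L)
    (h0 : L.count 0 ≤ N) : ∃ p S V, Builds N L p S V := by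
  induction L with
  | nil => exact ⟨_, _, _, nil⟩
  | cons c L ih =>
    obtain ⟨p, S, V, h⟩ := ih (fun M hM => hL M (hM.trans (List.suffix_cons c L)))
      (fun h => h1 (List.mem_cons_of_mem _ h)) ((List.count_le_count_cons).trans h0)
    have hc := h.counts
    rcases Nat.eq_zero_or_pos c with rfl | hpos
    · simp at h0
      obtain ⟨p, rfl⟩ : ∃ p', p = p' + 1 := ⟨p - 1, by omega⟩
      exact ⟨_, _, _, leaf h⟩
    · have hs := hL _ List.suffix_rfl
      simp at hs h1
      have hlt : c - 1 < V.length := by omega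
      have hV : V = V.take (c - 1) ++ V[c - 1] :: V.drop (c - 1 + 1) := by simp
      have hlen : (V.take (c - 1)).length + 1 = c := by simp; omega
      rw [hV] at h
      have := node h (by rintro h'; rw [h'] at hlen; simp at hlen; omega)
      rw [hlen] at this
      exact ⟨_, _, _, this⟩

theorem unique_of_list {p' : ℕ} {S' : Finset (ℕ × ℕ)} {V' : List ℕ}
    (h : Builds N L p S V) (h' : Builds N L p' S' V') : p = p' ∧ S = S' ∧ V = V' := by
  induction h generalizing p' S' V' with
  | nil => cases h'; simp
  | leaf _ ih => 
    cases h' with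
    | leaf h' => 
      obtain ⟨h1, h2, h3⟩ := ih h'
      simp_all
  | @node L p q S V₁ V₂ h hV ih =>
    generalize hK : (V₁.length + 1) :: L = K at h'
    cases h' with
    | nil => simp at hK
    | leaf h' => simp at hK
    | node h' hV' => 
      simp only [List.cons.injEq, Nat.add_right_cancel_iff] at hK
      obtain ⟨hlen, rfl⟩ := hK
      obtain ⟨rfl, rfl, h3⟩ := ih h'
      obtain ⟨rfl, h4⟩ := List.append_inj h3 hlen
      simp_all

theorem exists_of_noncrossing (hp : p ≤ N)
    (hS : ∀ c ∈ S, p ≤ c.1 ∧ c.1 + 1 < c.2 ∧ c.2 ≤ N + 1)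
    (hx : ∀ c ∈ S, ∀ d ∈ S, ¬(c.1 < d.1 ∧ d.1 < c.2 ∧ c.2 < d.2)) :
    ∃ L V, Builds N L p S V := by
  induction hm : (N - p) + S.card using Nat.strong_induction_on generalizing p S with
  | _ m ih =>
  subst hm
  rcases (S.filter fun c => c.1 = p).eq_empty_or_nonempty with he | hne
  · have hne : ∀ c ∈ S, c.1 ≠ p := by simpa [Finset.filter_eq_empty_iff] using he
    rcases hp.eq_or_lt with rfl | hlt
    · have : S = ∅ := Finset.eq_empty_of_forall_notMem fun c hc => by
        have := hS c hc; omega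
      subst this
      exact ⟨_, _, nil⟩
    · obtain ⟨L, V, h⟩ := ih _ (by omega) (p := p + 1) (S := S) hlt
        (fun c hc => ⟨by have := hS c hc; have := hne c hc; omega, (hS c hc).2⟩) hx rfl
      exact ⟨_, _, leaf h⟩
  · obtain ⟨⟨p', q⟩, hc, hmax⟩ := Finset.exists_max_image _ Prod.snd hne
    obtain ⟨hcS, rfl⟩ := Finset.mem_filter.1 hc
    simp only [Finset.mem_filter] at hmax
    have hsub : S.erase (p', q) ⊆ S := Finset.erase_subset _ _
    obtain ⟨L, V, h⟩ := ih _ (by rw [← Finset.card_erase_add_one hcS]; omega) hp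
        (S := S.erase (p', q))
        (fun c hc => hS c (hsub hc)) (fun c hc d hd => hx c (hsub hc) d (hsub hd)) rfl
    have hcq := hS _ hcS
    simp only at hcq
    have hqV : q ∈ V := by
      refine (h.vertices.2.2.2 q).2 ⟨by omega, hcq.2.2, fun d hd hdq => ?_⟩
      have hd' := hsub hd
      rcases (hS d hd').1.eq_or_lt with he | hlt
      · have := hmax d ⟨hd', he.symm⟩
        omega
      · exact hx _ hcS d hd' ⟨hlt, hdq⟩
    obtain ⟨V₁, V₂, rfl⟩ := List.append_of_mem hqV
    have hV : V₁ ≠ [] := by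
      rintro rfl
      obtain ⟨x, W, hW, h1, -⟩ := h.head_spec
      simp at hW
      obtain ⟨rfl, rfl⟩ := hW
      simp at h1
      omega
    have := node h hV
    rw [Finset.insert_erase hcS] at this
    exact ⟨_, _, this⟩

theorem unique_of_noncrossing {L' V' : List ℕ}
    (h : Builds N L p S V) (h' : Builds N L' p S V') : L = L' := by
  induction h generalizing L' V' with
  | nil =>
    generalize hT : (∅ : Finset (ℕ × ℕ)) = T at h'
    cases h' with
    | nil => rfl
    | leaf h' => have := h'.vertices.1; omega
    | node h' _ => exact absurd hT.symm (Finset.insert_ne_empty _ _)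
  | @leaf L p S V h ih =>
    cases h' with
    | nil => have := h.vertices.1; omega
    | leaf h' => rw [ih h']
    | node h' _ =>
      have := h.vertices.2.1 _ (Finset.mem_insert_self _ _)
      simp at this
  | @node L p q S V₁ V₂ h hV ih =>
    have hb := (node h hV).head_spec
    generalize hT : insert (p, q) S = T at h'
    cases h' with
    | nil => simp at hT
    | leaf h' =>
      have := h'.vertices.2.1 (p, q) (hT ▸ Finset.mem_insert_self _ _)
      simp at this
    | @node L' _ q' S' W₁ W₂ h' hV' =>
      have hb' := (node h' hV').head_spec
      simp only [List.cons.injEq] at hb hb'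
      obtain ⟨_, _, ⟨rfl, rfl⟩, -, hb⟩ := hb
      obtain ⟨_, _, ⟨rfl, rfl⟩, -, hb'⟩ := hb'
      have h1 := hb q' (hT ▸ Finset.mem_insert_self _ _)
      have h2 := hb' q (hT ▸ Finset.mem_insert_self _ _)
      obtain rfl : q = q' := le_antisymm h2 h1
      have hSS : S = S' := by
        rw [← Finset.erase_insert (h.notMem hV), hT, Finset.erase_insert (h'.notMem hV')]
      subst hSS
      obtain rfl := ih h'
      have hVV := (h.unique_of_list h').2.2
      have hlen : V₁ = W₁ := by
        have hs := h.vertices.2.2.1.nodup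
        have hs' := h'.vertices.2.2.1.nodup
        refine (List.append_cons_inj_of_notMem ?_ ?_).1 hVV |>.1
        · simp [List.nodup_append] at hs; grind
        · simp [List.nodup_append] at hs'; grind
      rw [hlen]

end Builds

/-- The word `U^{c_1} D ⋯ U^{c_m} D` attached to the list `c_1, …, c_m`. -/
def ascentWord (L : List ℕ) : List Bool :=
  L.flatMap fun c => List.replicate c true ++ [false]

namespace ascentWord

@[simp] theorem nil : ascentWord [] = [] := rfl

@[simp] theorem cons (c : ℕ) (L : List ℕ) :
    ascentWord (c :: L) = List.replicate c true ++ false :: ascentWord L := by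
  simp [ascentWord]

@[simp] theorem append (L M : List ℕ) : ascentWord (L ++ M) = ascentWord L ++ ascentWord M := by
  simp [ascentWord]

theorem injective : Function.Injective ascentWord := by
  intro L M h
  induction L generalizing M with
  | nil => cases M <;> simp at h ⊢
  | cons c L ih =>
    cases M with
    | nil => simp at h
    | cons d M =>
      simp only [cons] at h
      induction c generalizing d with
      | zero =>
        cases d with
        | zero => rw [ih (by simpa using h)]
        | succ d => simp [List.replicate_succ] at h
      | succ c ihc =>
        cases d with
        | zero => simp [List.replicate_succ] at h
        | succ d => simpa using ihc d (by simpa [List.replicate_succ] using h)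

@[simp] theorem count_false (L : List ℕ) : (ascentWord L).count false = L.length := by
  induction L <;> simp_all [List.count_replicate]

@[simp] theorem count_true (L : List ℕ) : (ascentWord L).count true = L.sum := by
  induction L <;> simp_all

theorem exists_append_replicate (w : List Bool) :
    ∃ L a, w = ascentWord L ++ List.replicate a true := by
  induction w with
  | nil => exact ⟨[], 0, rfl⟩
  | cons b w ih =>
    obtain ⟨L, a, rfl⟩ := ih
    cases b with
    | false => exact ⟨0 :: L, a, by simp⟩
    | true =>
      cases L with
      | nil => exact ⟨[], a + 1, by simp [List.replicate_succ]⟩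
      | cons c L => exact ⟨(c + 1) :: L, a, by simp [List.replicate_succ]⟩

theorem ascentLengths_false_cons (w : List Bool) :
    ascentLengths (false :: w) = ascentLengths w := by
  have hrep : ∀ k, (List.replicate (k + 1) false).splitBy (· == ·) =
      [List.replicate (k + 1) false] := fun k =>
    List.splitBy_of_isChain (by simp) (List.isChain_replicate_of_rel _ (by simp))
  have key : ∀ k v, (∀ b ∈ v.head?, b = true) →
      ascentLengths (List.replicate k false ++ v) = ascentLengths v := by
    intro k v hv
    cases k with
    | zero => simp
    | succ k =>
      unfold ascentLengths
      rw [List.splitBy_append, hrep]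
      · simp [List.replicate_succ]
      · intro x hx y hy
        rw [hv y hy]
        simp [List.getLast?_replicate] at hx
        simp [← hx]
  obtain ⟨k, v, hv, rfl⟩ : ∃ k v, (∀ b ∈ v.head?, b = true) ∧
      w = List.replicate k false ++ v := by
    induction w with
    | nil => exact ⟨0, [], by simp⟩
    | cons b w ih =>
      cases b with
      | true => exact ⟨0, true :: w, by simp⟩
      | false =>
        obtain ⟨k, v, hv, rfl⟩ := ih
        exact ⟨k + 1, v, hv, by simp [List.replicate_succ]⟩
  rw [key k v hv, ← key (k + 1) v hv, List.replicate_succ, List.cons_append]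

theorem ascentLengths_eq (L : List ℕ) :
    ascentLengths (ascentWord L) = L.filter (· ≠ 0) := by
  induction L with
  | nil => rfl
  | cons c L ih =>
    cases c with
    | zero => simpa [ascentLengths_false_cons] using ih
    | succ c =>
      have hrep : (List.replicate (c + 1) true).splitBy (· == ·) =
          [List.replicate (c + 1) true] :=
        List.splitBy_of_isChain (by simp) (List.isChain_replicate_of_rel _ (by simp))
      have h := (ascentLengths_false_cons (ascentWord L)).trans ih
      unfold ascentLengths at h
      rw [cons, ascentLengths, List.splitBy_append_cons, hrep, List.filter_append,
        List.map_append, h]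
      · simp [List.replicate_succ, List.filter_cons]
      · intro x hx
        simp [List.getLast?_replicate] at hx
        simp [← hx]

theorem prefix_iff (L : List ℕ) :
    (∀ p, p <+: ascentWord L → p.count false ≤ p.count true) ↔
      ∀ M, M <+: L → M.length ≤ M.sum := by
  constructor
  · rintro h M ⟨K, rfl⟩
    simpa using h (ascentWord M) ⟨ascentWord K, by simp⟩
  · intro h p hp
    obtain ⟨M, a, rfl⟩ := exists_append_replicate p
    obtain ⟨t, ht⟩ := hp
    obtain ⟨K, b, hK⟩ := exists_append_replicate (List.replicate a true ++ t)
    have hL : M ++ K ++ [b] = L ++ [0] := injective <| by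
      simp [← ht, hK]
    have hM := h M ⟨K, (List.append_inj' hL rfl).1⟩
    simp [List.count_replicate]
    omega

end ascentWord

theorem exists_ascentWord_of_mem {n l s : ℕ} {w : List Bool} (hw : w ∈ DyckSet n l s) :
    ∃ L, w = ascentWord L := by
  obtain ⟨-, hc, hp, -⟩ := hw
  obtain ⟨L, a, rfl⟩ := ascentWord.exists_append_replicate w
  have := hp (ascentWord L) (List.prefix_append _ _)
  have ha : a = 0 := by simp [List.count_replicate] at *; omega
  exact ⟨L, by simp [ha]⟩

theorem ascentWord_mem_iff {n l : ℕ} {L : List ℕ} :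
    ascentWord L ∈ DyckSet n l 0 ↔ L.length = n ∧ L.sum = n ∧ L.count 0 + l = n ∧ 1 ∉ L ∧
      ∀ M, M <:+ L → M.sum ≤ M.length := by
  have hlen : (ascentWord L).length = L.length + L.sum := by
    rw [← List.count_false_add_count_true]; simp
  have hsuf (h : L.length = L.sum) : (∀ M, M <+: L → M.length ≤ M.sum) ↔
      ∀ M, M <:+ L → M.sum ≤ M.length := by
    constructor
    · rintro h' M ⟨K, rfl⟩
      have := h' K (List.prefix_append _ _)
      simp at h; omega
    · rintro h' M ⟨K, rfl⟩
      have := h' K (List.suffix_append _ _)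
      simp at h; omega
  have hone : ((L.filter (· ≠ 0)).filter fun x => decide (x = 1)).length = 0 ↔ 1 ∉ L := by
    simp only [List.length_eq_zero_iff, List.filter_eq_nil_iff, List.mem_filter,
      decide_eq_true_eq]
    exact ⟨fun h h1 => h 1 ⟨h1, one_ne_zero⟩ rfl, fun h a ha h1 => h (h1 ▸ ha.1)⟩
  have hlong (h : 1 ∉ L) :
      ((L.filter (· ≠ 0)).filter fun x => decide (2 ≤ x)).length + L.count 0 = L.length := by
    clear hlen hsuf hone
    induction L with
    | nil => rfl
    | cons c L ih =>
      simp only [List.mem_cons, not_or] at h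
      have := ih h.2
      rcases Nat.eq_zero_or_pos c with rfl | hpos
      · simpa [← add_assoc] using this
      · have h2 : 2 ≤ c := by omega
        have h0 : c ≠ 0 := by omega
        simp [h2, h0] at this ⊢
        omega
  rw [DyckSet, Set.mem_ofPred_eq, hlen, ascentWord.count_false, ascentWord.count_true,
    ascentWord.prefix_iff, ascentWord.ascentLengths_eq, hone]
  constructor
  · rintro ⟨h1, h2, h3, h4, h5, -⟩
    have := hlong h5
    exact ⟨by omega, by omega, by omega, h5, (hsuf h2.symm).1 h3⟩
  · rintro ⟨h1, h2, h3, h4, h5⟩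
    have := hlong h4
    refine ⟨by omega, by omega, (hsuf (by omega)).2 h5, by omega, h4, fun j hj => ?_⟩
    have : 1 ∈ L.filter (· ≠ 0) := by
      rw [← hj]
      by_cases hlt : j < (L.filter (· ≠ 0)).length
      · rw [List.getD_eq_getElem _ _ hlt]
        exact List.getElem_mem hlt
      · rw [List.getD_eq_default _ _ (by omega)] at hj
        omega
    exact absurd (List.mem_of_mem_filter this) h4

theorem exists_builds_of_dissection {n k : ℕ} {S : Finset (ℕ × ℕ)} (hn : 2 ≤ n)
    (hS : S ∈ DisSet (n + 2) k) :
    ∃ L, Builds (n + 1) L 1 (insert (1, n + 2) S) [n + 2] := by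
  obtain ⟨⟨hc, hx⟩, -⟩ := hS
  simp only [IsChord] at hc
  obtain ⟨L, V, h⟩ := Builds.exists_of_noncrossing (N := n + 1) (p := 1)
    (S := insert (1, n + 2) S) (by omega)
    (by
      rw [Finset.forall_mem_insert]
      refine ⟨by simp; omega, fun c h => ?_⟩
      have := hc c h
      omega)
    (by
      intro c h d h'
      rcases Finset.mem_insert.1 h with rfl | h <;> rcases Finset.mem_insert.1 h' with rfl | h'
      · simp
      · have := hc d h'
        simp; omega
      · have := hc c h
        simp; omega
      · intro hcr
        refine hx c h d h' ?_ (Or.inl hcr)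
        rintro rfl
        omega)
  obtain ⟨x, W, rfl, -, hle⟩ := h.head_spec
  obtain ⟨-, -, hsort, hmem⟩ := h.vertices
  have h1 := hle _ (Finset.mem_insert_self _ _)
  have h2 := (hmem x).1 (by simp)
  obtain rfl : x = n + 2 := by omega
  cases W with
  | nil => exact ⟨L, h⟩
  | cons y W =>
    have h3 := (hmem y).1 (by simp)
    rw [List.pairwise_cons] at hsort
    have := hsort.1 y (by simp)
    omega

theorem Builds.exists_dissection {n : ℕ} {L : List ℕ} {T : Finset (ℕ × ℕ)} (hn : 2 ≤ n)
    (h : Builds (n + 1) L 1 T [n + 2]) :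
    ∃ S ∈ DisSet (n + 2) (T.card - 1), T = insert (1, n + 2) S := by
  have hmem : (1, n + 2) ∈ T := by
    obtain ⟨x, W, hx, hT, -⟩ := h.head_spec
    simp at hx
    obtain ⟨rfl, rfl⟩ := hx
    exact hT.resolve_left (by omega)
  obtain ⟨-, hv, -⟩ := h.vertices
  refine ⟨T.erase (1, n + 2), ⟨⟨fun c hc => ?_, fun c hc d hd _ hcr => ?_⟩, ?_⟩,
    (Finset.insert_erase hmem).symm⟩
  · obtain ⟨hne, hc⟩ := Finset.mem_erase.1 hc
    have := hv c hc
    exact ⟨this.1, this.2.1, this.2.2, fun he => hne (Prod.ext he.1 he.2)⟩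
  · have hc := Finset.mem_of_mem_erase hc
    have hd := Finset.mem_of_mem_erase hd
    rcases hcr with hcr | hcr
    · exact h.noncrossing c hc d hd hcr
    · exact h.noncrossing d hd c hc hcr
  · exact Finset.card_erase_of_mem hmem

theorem notMem_dissection {n k : ℕ} {S : Finset (ℕ × ℕ)} (hS : S ∈ DisSet n k) :
    (1, n) ∉ S := fun h => (hS.1.1 _ h).2.2.2 ⟨rfl, rfl⟩

theorem Builds.ascentWord_mem {n i : ℕ} {L : List ℕ} {S : Finset (ℕ × ℕ)}
    (hS : S ∈ DisSet (n + 2) i) (h : Builds (n + 1) L 1 (insert (1, n + 2) S) [n + 2]) :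
    ascentWord L ∈ DyckSet (n + i + 1) (i + 1) 0 := by
  have hc := h.counts
  rw [Finset.card_insert_of_notMem (notMem_dissection hS), hS.2, List.length_singleton] at hc
  exact ascentWord_mem_iff.2
    ⟨by omega, by omega, by omega, hc.2.2.2, h.suffix_sum_le⟩

theorem exists_builds_of_ascentWord {n i : ℕ} {L : List ℕ} (hn : 2 ≤ n)
    (hL : ascentWord L ∈ DyckSet (n + i + 1) (i + 1) 0) :
    ∃ S ∈ DisSet (n + 2) i, Builds (n + 1) L 1 (insert (1, n + 2) S) [n + 2] := by
  obtain ⟨h1, h2, h3, h4, h5⟩ := ascentWord_mem_iff.1 hL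
  obtain ⟨p, T, V, h⟩ := Builds.exists_of_list (N := n + 1) h5 h4 (by omega)
  have hc := h.counts
  obtain rfl : p = 1 := by omega
  obtain ⟨x, rfl⟩ := List.length_eq_one_iff.1 (show V.length = 1 by omega)
  have hx := (h.vertices.2.2.2 (n + 2)).2
    ⟨by omega, le_rfl, fun c hc => by have := h.vertices.2.1 c hc; omega⟩
  obtain rfl := List.mem_singleton.1 hx
  obtain ⟨S, hS, rfl⟩ := h.exists_dissection hn
  refine ⟨S, ?_, h⟩
  convert hS
  omega

/-- For all integers `n`, `i` with `1 ≤ i ≤ n - 1`, `Dis(n+2, i)` and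
`Dyck(n+i+1, i+1, 0)` have the same cardinality. -/
theorem dis_equiv_dyck (n i : ℕ) (hi : 1 ≤ i) (hin : i + 1 ≤ n) :
    Nonempty (↥(DisSet (n + 2) i) ≃ ↥(DyckSet (n + i + 1) (i + 1) 0)) := by
  have hn : 2 ≤ n := by omega
  choose L hL using fun S : DisSet (n + 2) i => exists_builds_of_dissection hn S.2
  refine ⟨Equiv.ofBijective (fun S => ⟨ascentWord (L S), (hL S).ascentWord_mem S.2⟩) ⟨?_, ?_⟩⟩
  · intro S T hST
    have hLL : L S = L T := ascentWord.injective (congrArg Subtype.val hST)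
    have h := ((hL S).unique_of_list (hLL ▸ hL T)).2.1
    apply Subtype.ext
    rw [← Finset.erase_insert (notMem_dissection S.2), h,
      Finset.erase_insert (notMem_dissection T.2)]
  · rintro ⟨w, hw⟩
    obtain ⟨M, rfl⟩ := exists_ascentWord_of_mem hw
    obtain ⟨S, hS, h⟩ := exists_builds_of_ascentWord hn hw
    exact ⟨⟨S, hS⟩, Subtype.ext (congrArg ascentWord ((hL ⟨S, hS⟩).unique_of_noncrossing h))⟩
end

section
/- For all integers n and i with 1 ≤ i ≤ n−1, the set Dis(n+2,i) of dissections of an (n+2)-gon with i chords and the set Tri(n+i+3, i+1, 0) of triangulations of an (n+i+3)-gon whose fan decomposition has i+1 fans, none of which is singular, have the same cardinality. -/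
/-! ## Marked binary trees -/

/-- Binary trees in which every internal node carries a mark for its left subtree. -/
inductive MarkedTree where
  | leaf : MarkedTree
  | node (L : MarkedTree) (mk : Bool) (R : MarkedTree) : MarkedTree

namespace MarkedTree

/-- The number of leaves. -/
def leaves : MarkedTree → ℕ
  | leaf => 1
  | node L _ R => L.leaves + R.leaves

/-- Left subtrees which are leaves are marked. -/
def Valid : MarkedTree → Prop
  | leaf => True
  | node L mk R => L.Valid ∧ R.Valid ∧ (L.leaves = 1 → mk = true)

/-- All left subtrees are marked. -/
def AllMarked : MarkedTree → Prop
  | leaf => True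
  | node L mk R => L.AllMarked ∧ R.AllMarked ∧ mk = true

/-- The segment `(p, p + w)`, when it is not an edge of the polygon. -/
def side (p w : ℕ) : Finset (ℕ × ℕ) := if 1 < w then {(p, p + w)} else ∅

/-- The chords on the interval `[p, p + leaves]` encoded by a marked tree: every right subtree and
every marked left subtree contributes the segment which it spans. -/
def chords : ℕ → MarkedTree → Finset (ℕ × ℕ)
  | _, leaf => ∅
  | p, node L mk R => (chords p L ∪ if mk then side p L.leaves else ∅) ∪
      (chords (p + L.leaves) R ∪ side (p + L.leaves) R.leaves)

/-- The number of chords encoded by a marked tree. -/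
def chordCount : MarkedTree → ℕ
  | leaf => 0
  | node L mk R => (L.chordCount + if mk = true ∧ 1 < L.leaves then 1 else 0) +
      (R.chordCount + if 1 < R.leaves then 1 else 0)

theorem one_le_leaves (T : MarkedTree) : 1 ≤ T.leaves := by
  induction T with
  | leaf => simp [leaves]
  | node L mk R hL hR => simp only [leaves]; omega

theorem leaves_node (L R : MarkedTree) (mk : Bool) :
    (node L mk R).leaves = L.leaves + R.leaves := rfl

theorem eq_leaf_of_leaves_eq_one {T : MarkedTree} (h : T.leaves = 1) : T = leaf := by
  cases T with
  | leaf => rfl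
  | node L mk R =>
    have := L.one_le_leaves
    have := R.one_le_leaves
    simp only [leaves] at h
    omega

theorem AllMarked.valid {T : MarkedTree} (h : T.AllMarked) : T.Valid := by
  induction T with
  | leaf => trivial
  | node L mk R hL hR => exact ⟨hL h.1, hR h.2.1, fun _ => h.2.2⟩

theorem mem_side {p w : ℕ} {c : ℕ × ℕ} : c ∈ side p w ↔ 1 < w ∧ c = (p, p + w) := by
  unfold side; split_ifs <;> simp_all

theorem mem_chords_node {p : ℕ} {L R : MarkedTree} {mk : Bool} {c : ℕ × ℕ} :
    c ∈ chords p (node L mk R) ↔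
      (c ∈ chords p L ∨ (mk = true ∧ 1 < L.leaves ∧ c = (p, p + L.leaves))) ∨
      (c ∈ chords (p + L.leaves) R ∨
        (1 < R.leaves ∧ c = (p + L.leaves, p + L.leaves + R.leaves))) := by
  cases mk <;> simp [chords, mem_side, or_assoc]

/-- `c` joins two non-consecutive elements of `[p, p + w]`, not both of them extremal. -/
def Inner (p w : ℕ) (c : ℕ × ℕ) : Prop :=
  p ≤ c.1 ∧ c.1 + 1 < c.2 ∧ c.2 ≤ p + w ∧ ¬(c.1 = p ∧ c.2 = p + w)

theorem inner_of_mem_chords {T : MarkedTree} {p : ℕ} {c : ℕ × ℕ} (h : c ∈ chords p T) :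
    Inner p T.leaves c := by
  induction T generalizing p with
  | leaf => simp [chords] at h
  | node L mk R hL hR =>
    have h1 := L.one_le_leaves
    have h2 := R.one_le_leaves
    unfold Inner at *
    rw [leaves_node]
    rcases mem_chords_node.1 h with (h | ⟨-, h, rfl⟩) | (h | ⟨h, rfl⟩)
    · have := hL h; omega
    · simp only; omega
    · have := hR h; omega
    · simp only; omega

theorem not_crosses_of_mem_chords {T : MarkedTree} {p : ℕ} {c d : ℕ × ℕ} (hc : c ∈ chords p T)
    (hd : d ∈ chords p T) : ¬Crosses c d := by
  induction T generalizing p with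
  | leaf => simp [chords] at hc
  | node L mk R hL hR =>
    have h1 := L.one_le_leaves
    have h2 := R.one_le_leaves
    rcases mem_chords_node.1 hc with (h | ⟨-, h, rfl⟩) | (h | ⟨h, rfl⟩) <;>
    rcases mem_chords_node.1 hd with (h' | ⟨-, h', rfl⟩) | (h' | ⟨h', rfl⟩)
    case inl.inl.inl.inl => exact hL h h'
    case inr.inl.inr.inl => exact hR h h'
    all_goals
      try have := inner_of_mem_chords h
      try have := inner_of_mem_chords h'
      simp only [Inner, Crosses] at *
      omega

theorem card_side (p w : ℕ) : (side p w).card = if 1 < w then 1 else 0 := by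
  unfold side; split_ifs <;> rfl

theorem card_chords (T : MarkedTree) (p : ℕ) : (chords p T).card = T.chordCount := by
  induction T generalizing p with
  | leaf => rfl
  | node L mk R hL hR =>
    rw [chords, Finset.card_union_of_disjoint, Finset.card_union_of_disjoint,
      Finset.card_union_of_disjoint, hL, hR, card_side, chordCount]
    · cases mk <;> simp [card_side]
    · rw [Finset.disjoint_left]
      intro c hc hc'
      have := inner_of_mem_chords hc
      rw [mem_side] at hc'
      obtain ⟨_, rfl⟩ := hc'
      simp [Inner] at this
    · rw [Finset.disjoint_left]
      intro c hc hc'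
      have := inner_of_mem_chords hc
      split_ifs at hc'
      · rw [mem_side] at hc'
        obtain ⟨_, rfl⟩ := hc'
        simp [Inner] at this
      · simp at hc'
    · rw [Finset.disjoint_left]
      intro c hc hc'
      have h1 : c.1 < c.2 ∧ c.2 ≤ p + L.leaves := by
        rcases Finset.mem_union.1 hc with h | h
        · have := inner_of_mem_chords h
          simp only [Inner] at this; omega
        · split_ifs at h
          · obtain ⟨_, rfl⟩ := mem_side.1 h
            simp only; omega
          · simp at h
      have h2 : p + L.leaves ≤ c.1 := by
        rcases Finset.mem_union.1 hc' with h | h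
        · have := inner_of_mem_chords h
          simp only [Inner] at this; omega
        · obtain ⟨_, rfl⟩ := mem_side.1 h
          simp only; omega
      omega

theorem exists_chords_eq {w : ℕ} (hw : 1 ≤ w) {p : ℕ} {S : Finset (ℕ × ℕ)}
    (hS : ∀ c ∈ S, Inner p w c) (hX : ∀ c ∈ S, ∀ d ∈ S, ¬Crosses c d) :
    ∃ T : MarkedTree, T.Valid ∧ T.leaves = w ∧ chords p T = S := by
  induction w using Nat.strong_induction_on generalizing p S with
  | _ w ih =>
  rcases hw.eq_or_lt with rfl | hw
  · refine ⟨leaf, trivial, rfl, ?_⟩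
    rw [chords, eq_comm, Finset.eq_empty_iff_forall_notMem]
    intro c hc
    have := hS c hc
    simp only [Inner] at this
    omega
  classical
  have hex : ∃ a, 0 < a ∧ (a + 1 = w ∨ (p + a, p + w) ∈ S) := ⟨w - 1, by omega, by omega⟩
  obtain ⟨a, ⟨ha, hr⟩, hmin⟩ : ∃ a, (0 < a ∧ (a + 1 = w ∨ (p + a, p + w) ∈ S)) ∧
      ∀ b < a, ¬(0 < b ∧ (b + 1 = w ∨ (p + b, p + w) ∈ S)) :=
    ⟨Nat.find hex, Nat.find_spec hex, fun b hb => Nat.find_min hex hb⟩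
  have haw : a < w := by
    rcases hr with h | h
    · omega
    · have := hS _ h
      simp only [Inner] at this
      omega
  have hsplit : ∀ c ∈ S, c.2 ≤ p + a ∨ p + a ≤ c.1 := by
    intro c hc
    by_contra! hcon
    have hi := hS c hc
    simp only [Inner] at hi
    by_cases h2 : c.2 = p + w
    · refine hmin (c.1 - p) (by omega) ⟨by omega, Or.inr ?_⟩
      have : c = (p + (c.1 - p), p + w) := Prod.ext (by simp only; omega) h2
      rwa [← this]
    · rcases hr with h | h
      · omega
      · refine hX c hc _ h (Or.inl ?_)
        simp only
        omega
  obtain ⟨L, hLv, hLl, hLc⟩ := ih a haw ha (p := p)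
    (S := S.filter fun c => c.2 ≤ p + a ∧ c ≠ (p, p + a))
    (by
      intro c hc
      simp only [Finset.mem_filter, ne_eq, Prod.ext_iff] at hc
      have := hS c hc.1
      simp only [Inner] at *
      omega)
    (fun c hc d hd => hX c (Finset.mem_filter.1 hc).1 d (Finset.mem_filter.1 hd).1)
  obtain ⟨R, hRv, hRl, hRc⟩ := ih (w - a) (by omega) (by omega) (p := p + a)
    (S := S.filter fun c => p + a ≤ c.1 ∧ c ≠ (p + a, p + w))
    (by
      intro c hc
      simp only [Finset.mem_filter, ne_eq, Prod.ext_iff] at hc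
      have := hS c hc.1
      simp only [Inner] at *
      omega)
    (fun c hc d hd => hX c (Finset.mem_filter.1 hc).1 d (Finset.mem_filter.1 hd).1)
  refine ⟨node L (decide (a = 1 ∨ (p, p + a) ∈ S)) R, ⟨hLv, hRv, fun h => ?_⟩, ?_, ?_⟩
  · simp [← hLl, h]
  · rw [leaves_node]; omega
  · ext c
    have hpw : p + a + (w - a) = p + w := by omega
    rw [mem_chords_node, hLl, hRl, hLc, hRc, hpw]
    simp only [Finset.mem_filter, decide_eq_true_eq]
    constructor
    · rintro ((h | ⟨h, h1, rfl⟩) | (h | ⟨h, rfl⟩))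
      · exact h.1
      · exact h.resolve_left (by omega)
      · exact h.1
      · exact hr.resolve_left (by omega)
    · intro hc
      have hi := hS c hc
      simp only [Inner] at hi
      rcases hsplit c hc with h | h
      · left
        by_cases he : c = (p, p + a)
        · subst he
          simp only at hi
          exact Or.inr ⟨Or.inr hc, by omega, rfl⟩
        · exact Or.inl ⟨hc, h, he⟩
      · right
        by_cases he : c = (p + a, p + w)
        · subst he
          simp only at hi
          exact Or.inr ⟨by omega, rfl⟩
        · exact Or.inl ⟨hc, h, he⟩

theorem mem_chords_left_iff {p : ℕ} {L R : MarkedTree} {mk : Bool} {c : ℕ × ℕ} :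
    c ∈ chords p L ↔ c ∈ chords p (node L mk R) ∧ Inner p L.leaves c := by
  refine ⟨fun h => ⟨mem_chords_node.2 (Or.inl (Or.inl h)), inner_of_mem_chords h⟩, ?_⟩
  rintro ⟨h, hi⟩
  rcases mem_chords_node.1 h with (h | ⟨-, -, rfl⟩) | (h | ⟨-, rfl⟩)
  · exact h
  · simp [Inner] at hi
  · have := inner_of_mem_chords h
    simp only [Inner] at *
    omega
  · simp only [Inner] at hi
    omega

theorem mem_chords_right_iff {p : ℕ} {L R : MarkedTree} {mk : Bool} {c : ℕ × ℕ} :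
    c ∈ chords (p + L.leaves) R ↔
      c ∈ chords p (node L mk R) ∧ Inner (p + L.leaves) R.leaves c := by
  refine ⟨fun h => ⟨mem_chords_node.2 (Or.inr (Or.inl h)), inner_of_mem_chords h⟩, ?_⟩
  rintro ⟨h, hi⟩
  rcases mem_chords_node.1 h with (h | ⟨-, -, rfl⟩) | (h | ⟨-, rfl⟩)
  · have := inner_of_mem_chords h
    simp only [Inner] at *
    omega
  · simp only [Inner] at hi
    omega
  · exact h
  · simp [Inner] at hi

theorem left_segment_mem_chords_iff {p : ℕ} {L R : MarkedTree} {mk : Bool} :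
    (p, p + L.leaves) ∈ chords p (node L mk R) ↔ mk = true ∧ 1 < L.leaves := by
  rw [mem_chords_node]
  have h1 := L.one_le_leaves
  have hL : (p, p + L.leaves) ∉ chords p L := fun h => by
    simpa [Inner] using inner_of_mem_chords h
  have hR : (p, p + L.leaves) ∉ chords (p + L.leaves) R := fun h => by
    have := inner_of_mem_chords h
    simp only [Inner] at this
    omega
  have hR' : ¬(1 < R.leaves ∧ (p, p + L.leaves) = (p + L.leaves, p + L.leaves + R.leaves)) := by
    simp only [Prod.mk.injEq]; omega
  simp [hL, hR]; omega

theorem right_segment_mem_chords_iff {p : ℕ} {L R : MarkedTree} {mk : Bool} {x : ℕ} (hx : p < x)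
    (hxL : x ≤ p + L.leaves) : (x, p + (node L mk R).leaves) ∈ chords p (node L mk R) ↔
      x = p + L.leaves ∧ 1 < R.leaves := by
  have h2 := R.one_le_leaves
  rw [mem_chords_node, leaves_node]
  constructor
  · rintro ((h | ⟨-, -, h⟩) | (h | ⟨h, h'⟩))
    · have := inner_of_mem_chords h
      simp only [Inner] at this
      omega
    · simp only [Prod.mk.injEq] at h; omega
    · have := inner_of_mem_chords h
      simp only [Inner] at this
      omega
    · simp only [Prod.mk.injEq] at h'; omega
  · rintro ⟨rfl, h⟩
    exact Or.inr (Or.inr ⟨h, by simp [add_assoc]⟩)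

theorem leaves_left_le_of_chords_eq {p : ℕ} {L R L' R' : MarkedTree} {mk mk' : Bool}
    (hl : (node L mk R).leaves = (node L' mk' R').leaves)
    (h : chords p (node L mk R) = chords p (node L' mk' R')) : L'.leaves ≤ L.leaves := by
  by_contra! hlt
  have h1 := L.one_le_leaves
  have h2 := R'.one_le_leaves
  have hmem := (right_segment_mem_chords_iff (p := p) (L := L) (R := R) (mk := mk)
    (x := p + L.leaves) (by omega) le_rfl).2 ⟨rfl, by rw [leaves_node, leaves_node] at hl; omega⟩
  rw [hl, h, right_segment_mem_chords_iff (by omega) (by omega)] at hmem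
  omega

theorem eq_of_chords_eq {T T' : MarkedTree} {p : ℕ} (hT : T.Valid) (hT' : T'.Valid)
    (hl : T.leaves = T'.leaves) (h : chords p T = chords p T') : T = T' := by
  induction T generalizing p T' with
  | leaf => exact (eq_leaf_of_leaves_eq_one hl.symm).symm
  | node L mk R hL hR =>
    cases T' with
    | leaf => exact eq_leaf_of_leaves_eq_one hl
    | node L' mk' R' =>
      have hLl : L.leaves = L'.leaves :=
        le_antisymm (leaves_left_le_of_chords_eq hl.symm h.symm) (leaves_left_le_of_chords_eq hl h)
      have hRl : R.leaves = R'.leaves := by rw [leaves_node, leaves_node] at hl; omega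
      have e1 : L = L' := hL hT.1 hT'.1 hLl (p := p) <| by
        ext c
        rw [mem_chords_left_iff (L := L) (R := R) (mk := mk),
          mem_chords_left_iff (L := L') (R := R') (mk := mk'), h, hLl]
      have e2 : R = R' := hR hT.2.1 hT'.2.1 hRl (p := p + L.leaves) <| by
        ext c
        rw [mem_chords_right_iff (mk := mk), hLl, mem_chords_right_iff (mk := mk'), h, hRl]
      subst e1 e2
      have hm : (mk = true ∧ 1 < L.leaves) ↔ (mk' = true ∧ 1 < L.leaves) := by
        rw [← left_segment_mem_chords_iff (p := p) (R := R),
          ← left_segment_mem_chords_iff (p := p) (R := R), h]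
      have e3 : mk = mk' := by
        rcases L.one_le_leaves.eq_or_lt with h1 | h1
        · rw [hT.2.2 h1.symm, hT'.2.2 h1.symm]
        · simpa [h1, ← Bool.eq_iff_iff] using hm
      rw [e3]

theorem isChord_iff_inner {w : ℕ} {c : ℕ × ℕ} : IsChord (w + 1) c ↔ Inner 1 w c := by
  simp only [IsChord, Inner]
  omega

theorem isDissection_chords {w : ℕ} {T : MarkedTree} (h : T.leaves = w) :
    IsDissection (w + 1) (chords 1 T) := by
  subst h
  exact ⟨fun c hc => isChord_iff_inner.2 (inner_of_mem_chords hc),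
    fun c hc d hd _ => not_crosses_of_mem_chords hc hd⟩

theorem exists_of_isDissection {w : ℕ} (hw : 1 ≤ w) {S : Finset (ℕ × ℕ)}
    (h : IsDissection (w + 1) S) : ∃ T : MarkedTree, T.Valid ∧ T.leaves = w ∧ chords 1 T = S := by
  refine exists_chords_eq hw (fun c hc => isChord_iff_inner.1 (h.1 c hc)) fun c hc d hd => ?_
  by_cases hcd : c = d
  · subst hcd
    simp only [Crosses]
    omega
  · exact h.2 c hc d hd hcd

/-! ### Triangulations -/

theorem AllMarked.mem_chords {T : MarkedTree} (hT : T.AllMarked) {p : ℕ} {c : ℕ × ℕ}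
    (hc : Inner p T.leaves c) (hX : ∀ d ∈ chords p T, ¬Crosses c d) : c ∈ chords p T := by
  induction T generalizing p with
  | leaf => simp only [Inner, leaves] at hc; omega
  | node L mk R hL hR =>
    obtain ⟨hL', hR', rfl⟩ := hT
    have hc' := hc
    simp only [Inner, leaves_node] at hc'
    by_cases hl : c.2 ≤ p + L.leaves
    · by_cases he : c = (p, p + L.leaves)
      · rw [he] at hc' ⊢
        simp only at hc'
        exact left_segment_mem_chords_iff.2 ⟨rfl, by omega⟩
      · refine mem_chords_node.2 (Or.inl (Or.inl (hL hL' ?_ ?_)))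
        · simp only [Prod.ext_iff] at he
          simp only [Inner]; omega
        · exact fun d hd => hX d (mem_chords_node.2 (Or.inl (Or.inl hd)))
    by_cases hr : p + L.leaves ≤ c.1
    · by_cases he : c = (p + L.leaves, p + L.leaves + R.leaves)
      · rw [he] at hc' ⊢
        simp only at hc'
        exact mem_chords_node.2 (Or.inr (Or.inr ⟨by omega, rfl⟩))
      · refine mem_chords_node.2 (Or.inr (Or.inl (hR hR' ?_ ?_)))
        · simp only [Prod.ext_iff] at he
          simp only [Inner]; omega
        · exact fun d hd => hX d (mem_chords_node.2 (Or.inr (Or.inl hd)))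
    exfalso
    by_cases hp : c.1 = p
    · refine hX _ (mem_chords_node.2 (Or.inr (Or.inr ⟨by omega, rfl⟩))) ?_
      simp only [Crosses]; omega
    · refine hX _ (left_segment_mem_chords_iff.2 ⟨rfl, by omega⟩) ?_
      simp only [Crosses]; omega

theorem allMarked_of_maximal {T : MarkedTree} (hT : T.Valid) {p : ℕ}
    (h : ∀ c, Inner p T.leaves c → (∀ d ∈ chords p T, ¬Crosses c d) → c ∈ chords p T) :
    T.AllMarked := by
  induction T generalizing p with
  | leaf => trivial
  | node L mk R hL hR =>
    have h1 := L.one_le_leaves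
    have h2 := R.one_le_leaves
    refine ⟨hL hT.1 (p := p) fun c hc hX => ?_, hR hT.2.1 (p := p + L.leaves) fun c hc hX => ?_, ?_⟩
    · refine mem_chords_left_iff.2 ⟨h c ?_ fun d hd => ?_, hc⟩
      · simp only [Inner, leaves_node] at *; omega
      · rcases mem_chords_node.1 hd with (hd | ⟨-, -, rfl⟩) | (hd | ⟨-, rfl⟩)
        · exact hX d hd
        · simp only [Inner, Crosses] at *; omega
        · have := inner_of_mem_chords hd
          simp only [Inner, Crosses] at *; omega
        · simp only [Inner, Crosses] at *; omega
    · refine mem_chords_right_iff.2 ⟨h c ?_ fun d hd => ?_, hc⟩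
      · simp only [Inner, leaves_node] at *; omega
      · rcases mem_chords_node.1 hd with (hd | ⟨-, -, rfl⟩) | (hd | ⟨-, rfl⟩)
        · have := inner_of_mem_chords hd
          simp only [Inner, Crosses] at *; omega
        · simp only [Inner, Crosses] at *; omega
        · exact hX d hd
        · simp only [Inner, Crosses] at *; omega
    · rcases h1.eq_or_lt with h1 | h1
      · exact hT.2.2 h1.symm
      · refine (left_segment_mem_chords_iff.1 (h (p, p + L.leaves) ?_ fun d hd => ?_)).1
        · simp only [Inner, leaves_node]; omega
        · rcases mem_chords_node.1 hd with (hd | ⟨-, -, rfl⟩) | (hd | ⟨-, rfl⟩)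
          · have := inner_of_mem_chords hd
            simp only [Inner, Crosses] at *; omega
          · simp only [Crosses]; omega
          · have := inner_of_mem_chords hd
            simp only [Inner, Crosses] at *; omega
          · simp only [Crosses]; omega

theorem isTriangulation_chords_iff {w : ℕ} {T : MarkedTree} (hT : T.Valid) (h : T.leaves = w) :
    IsTriangulation (w + 1) (chords 1 T) ↔ T.AllMarked := by
  subst h
  constructor
  · exact fun hS => allMarked_of_maximal hT fun c hc => hS.2 c (isChord_iff_inner.2 hc)
  · exact fun hA => ⟨isDissection_chords rfl, fun c hc => hA.mem_chords (isChord_iff_inner.1 hc)⟩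

/-! ### Fans -/

/-- The number of nodes on the leftmost branch. -/
def depth : MarkedTree → ℕ
  | leaf => 0
  | node L _ _ => L.depth + 1

/-- The sizes of all fans but the first one. -/
def innerFans : MarkedTree → List ℕ
  | leaf => []
  | node L _ R => L.innerFans ++ if 1 < R.leaves then R.depth :: R.innerFans else []

/-- The sizes of the fans in the triangulation encoded by a tree. -/
def fans (T : MarkedTree) : List ℕ := if 1 < T.leaves then T.depth :: T.innerFans else []

/-- The neighbours of the vertex `p`, in increasing order, in the triangulation
of `[p, p + leaves]` encoded by a tree. -/
def link (p : ℕ) : MarkedTree → List ℕ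
  | leaf => [p + 1]
  | node L _ R => link p L ++ [p + L.leaves + R.leaves]

theorem link_ne_nil (p : ℕ) (T : MarkedTree) : link p T ≠ [] := by
  cases T <;> simp [link]

theorem getLast_link (p : ℕ) (T : MarkedTree) :
    (link p T).getLast (link_ne_nil p T) = p + T.leaves := by
  cases T <;> simp [link, leaves, add_assoc]

theorem mem_link {T : MarkedTree} (hT : T.AllMarked) {p x : ℕ} :
    x ∈ link p T ↔ x = p + 1 ∨ x = p + T.leaves ∨ (p, x) ∈ chords p T := by
  induction T with
  | leaf => simp [link, leaves, chords]
  | node L mk R hL hR =>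
    obtain ⟨hL', hR', rfl⟩ := hT
    have h1 := L.one_le_leaves
    have hRn : (p, x) ∉ chords (p + L.leaves) R := fun h => by
      have := inner_of_mem_chords h
      simp only [Inner] at this; omega
    rw [link, List.mem_append, hL hL', mem_chords_node, leaves_node]
    simp only [List.mem_singleton, Prod.mk.injEq, hRn, true_and, false_or]
    by_cases hc : (p, x) ∈ chords p L
    · simp [hc]
    · simp only [hc, false_or, or_false]
      omega

theorem pairwise_link (p : ℕ) (T : MarkedTree) : (link p T).Pairwise (· < ·) ∧
    ∀ x ∈ link p T, x ≤ p + T.leaves := by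
  induction T with
  | leaf => simp [link, leaves]
  | node L mk R hL hR =>
    have h2 := R.one_le_leaves
    rw [link, List.pairwise_append, leaves_node]
    refine ⟨⟨hL.1, by simp, fun x hx y hy => ?_⟩, fun x hx => ?_⟩
    · have := hL.2 x hx
      rw [List.mem_singleton] at hy
      omega
    · rcases List.mem_append.1 hx with hx | hx
      · have := hL.2 x hx; omega
      · rw [List.mem_singleton] at hx; omega

theorem length_link (p : ℕ) (T : MarkedTree) : (link p T).length = T.depth + 1 := by
  induction T with
  | leaf => rfl
  | node L mk R hL hR => simp [link, depth, hL]

theorem zip_tail_concat {α : Type*} (l : List α) (hl : l ≠ []) (a : α) :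
    (l ++ [a]).zip (l ++ [a]).tail = l.zip l.tail ++ [(l.getLast hl, a)] := by
  induction l with
  | nil => exact absurd rfl hl
  | cons b l ih =>
    cases l with
    | nil => simp
    | cons c l => simpa using ih (by simp)

/-- The list computed by `fanListAux` at `p` is `link p`. -/
theorem link_eq {T : MarkedTree} (hT : T.AllMarked) (h1 : 1 < T.leaves) {p : ℕ}
    {S : Finset (ℕ × ℕ)} (hS : ∀ c, Inner p T.leaves c → (c ∈ S ↔ c ∈ chords p T)) :
    (p + 1) :: (((S.filter fun c => c.1 = p ∧ p + 1 < c.2 ∧ c.2 < p + T.leaves).image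
      Prod.snd).sort (· ≤ ·) ++ [p + T.leaves]) = link p T := by
  have hmem : ∀ x, x ∈ ((S.filter fun c => c.1 = p ∧ p + 1 < c.2 ∧ c.2 < p + T.leaves).image
      Prod.snd).sort (· ≤ ·) ↔ p + 1 < x ∧ x < p + T.leaves ∧ (p, x) ∈ S := by
    intro x
    simp only [Finset.mem_sort, Finset.mem_image, Finset.mem_filter, Prod.exists, exists_eq_right]
    constructor
    · rintro ⟨a, ha, rfl, h⟩; exact ⟨h.1, h.2, ha⟩
    · rintro ⟨h, h', hx⟩; exact ⟨p, hx, rfl, h, h'⟩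
  refine List.Perm.eq_of_pairwise (le := (· < ·)) (fun a b _ _ h h' => (lt_asymm h h').elim) ?_
    (pairwise_link p T).1 ?_
  · rw [List.pairwise_cons, List.pairwise_append]
    refine ⟨fun x hx => ?_, Finset.sortedLT_sort _ |>.pairwise, by simp, fun x hx y hy => ?_⟩
    · rcases List.mem_append.1 hx with hx | hx
      · exact ((hmem x).1 hx).1
      · rw [List.mem_singleton] at hx; omega
    · rw [List.mem_singleton] at hy
      rw [hy]
      exact ((hmem x).1 hx).2.1
  · rw [List.perm_ext_iff_of_nodup]
    · intro x
      rw [List.mem_cons, List.mem_append, hmem, mem_link hT, List.mem_singleton]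
      constructor
      · rintro (h | ⟨h, h', hx⟩ | h)
        · exact Or.inl h
        · refine Or.inr (Or.inr ((hS _ ?_).1 hx))
          simp only [Inner]; omega
        · exact Or.inr (Or.inl h)
      · rintro (h | h | h)
        · exact Or.inl h
        · exact Or.inr (Or.inr h)
        · have hi := inner_of_mem_chords h
          refine Or.inr (Or.inl ⟨?_, ?_, (hS _ hi).2 h⟩) <;>
            simp only [Inner, true_and] at hi <;> omega
    · rw [List.nodup_cons, List.nodup_append]
      refine ⟨fun hx => ?_, Finset.sort_nodup _ _, by simp, fun x hx y hy => ?_⟩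
      · rcases List.mem_append.1 hx with hx | hx
        · have := ((hmem _).1 hx).1; omega
        · rw [List.mem_singleton] at hx; omega
      · rw [List.mem_singleton] at hy
        have := ((hmem x).1 hx).2.1
        omega
    · exact (pairwise_link p T).1.imp fun h => h.ne

theorem map_snd_fanListAux_succ {T : MarkedTree} (hT : T.AllMarked) {p fuel : ℕ}
    {S : Finset (ℕ × ℕ)} (hS : ∀ c, Inner p T.leaves c → (c ∈ S ↔ c ∈ chords p T))
    (h1 : 1 < T.leaves) :
    (fanListAux S (fuel + 1) p (p + T.leaves)).map Prod.snd =
      T.depth :: (((link p T).zip (link p T).tail).flatMap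
        fun q => fanListAux S fuel q.1 q.2).map Prod.snd := by
  have hl := link_eq hT h1 hS
  have hlen := length_link p T
  rw [fanListAux, if_neg (by omega)]
  simp only [hl, List.map_cons]
  rw [← hl] at hlen
  simp only [List.length_cons, List.length_append, List.length_nil] at hlen
  congr 1
  omega

theorem map_snd_flatMap_fanListAux {T : MarkedTree} (hT : T.AllMarked) {p fuel : ℕ}
    {S : Finset (ℕ × ℕ)} (hS : ∀ c, Inner p T.leaves c → (c ∈ S ↔ c ∈ chords p T))
    (hf : T.leaves ≤ fuel + 2) :
    (((link p T).zip (link p T).tail).flatMap fun q => fanListAux S fuel q.1 q.2).map Prod.snd =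
      T.innerFans := by
  induction T generalizing p fuel with
  | leaf => simp [link, innerFans]
  | node L mk R hL hR =>
    have h1 := L.one_le_leaves
    have h2 := R.one_le_leaves
    rw [leaves_node] at hf
    rw [link, zip_tail_concat _ (link_ne_nil p L), List.flatMap_append, List.map_append,
      hL hT.1 _ (by omega), innerFans]
    · congr 1
      simp only [List.flatMap_cons, List.flatMap_nil, List.append_nil, getLast_link]
      have hS' : ∀ c, Inner (p + L.leaves) R.leaves c →
          (c ∈ S ↔ c ∈ chords (p + L.leaves) R) := fun c hc => by
        rw [hS c (by simp only [Inner, leaves_node] at *; omega), mem_chords_right_iff (mk := mk)]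
        exact (and_iff_left hc).symm
      split_ifs with h3
      · obtain ⟨f, rfl⟩ : ∃ f, fuel = f + 1 := ⟨fuel - 1, by omega⟩
        rw [map_snd_fanListAux_succ hT.2.1 hS' h3, hR hT.2.1 hS' (by omega)]
      · cases fuel with
        | zero => rfl
        | succ f => rw [fanListAux, if_pos (by omega), List.map_nil]
    · intro c hc
      rw [hS c (by simp only [Inner, leaves_node] at *; omega), mem_chords_left_iff (L := L) (mk := mk)]
      exact (and_iff_left hc).symm

theorem map_snd_fanList {T : MarkedTree} (hT : T.AllMarked) {w : ℕ} (h : T.leaves = w) :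
    (fanList (chords 1 T) 1 (w + 1)).map Prod.snd = T.fans := by
  subst h
  rw [fanList, fans, Nat.add_sub_cancel, Nat.add_comm T.leaves 1]
  have h1 := T.one_le_leaves
  obtain ⟨f, hf⟩ : ∃ f, T.leaves = f + 1 := ⟨T.leaves - 1, by omega⟩
  split_ifs with h2
  · conv_lhs => enter [2, 2]; rw [hf]
    rw [map_snd_fanListAux_succ hT (fun _ _ => Iff.rfl) h2,
      map_snd_flatMap_fanListAux hT (fun _ _ => Iff.rfl) (by omega)]
  · conv_lhs => enter [2, 2]; rw [hf]
    rw [fanListAux, if_pos (by omega), List.map_nil]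

theorem chords_mem_triSet_iff {T : MarkedTree} (hT : T.Valid) {w t : ℕ} (h : T.leaves = w) :
    chords 1 T ∈ TriSet (w + 1) t 0 ↔ T.AllMarked ∧ T.fans.length = t ∧ 1 ∉ T.fans := by
  simp only [TriSet, Set.mem_ofPred_eq, isTriangulation_chords_iff hT h]
  refine and_congr_right fun hA => ?_
  rw [← map_snd_fanList hA h, List.length_map, Nat.add_zero]
  refine and_congr_right fun _ => ?_
  rw [List.length_eq_zero_iff, List.filter_eq_nil_iff]
  simp only [decide_eq_true_eq, List.mem_map, not_exists, not_and]
  refine ⟨fun h => h.1, fun h => ⟨h, ?_⟩⟩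
  rw [List.getLastD_eq_getLast?]
  cases hg : (fanList (chords 1 T) 1 (w + 1)).getLast? with
  | none => simp
  | some a => exact h a (List.mem_of_getLast? hg)

/-! ### From dissections to triangulations -/

/-- Turns a node with `k ≥ 2` branches of a dissection into a fan of `k` triangles. -/
def toFans : MarkedTree → MarkedTree
  | leaf => leaf
  | node L mk R => node (if mk then node leaf true L.toFans else L.toFans) true R.toFans

theorem allMarked_toFans (T : MarkedTree) : T.toFans.AllMarked := by
  induction T with
  | leaf => trivial
  | node L mk R hL hR => cases mk <;> simp_all [toFans, AllMarked]

theorem one_lt_leaves_toFans_iff (T : MarkedTree) : 1 < T.toFans.leaves ↔ 1 < T.leaves := by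
  cases T with
  | leaf => rfl
  | node L mk R =>
    simp only [toFans, leaves_node]
    have := L.one_le_leaves
    have := R.one_le_leaves
    have := R.toFans.one_le_leaves
    have := (if mk then node leaf true L.toFans else L.toFans).one_le_leaves
    omega

theorem length_fans_toFans {T : MarkedTree} (hT : T.Valid) :
    T.toFans.fans.length = T.chordCount + if 1 < T.leaves then 1 else 0 := by
  induction T with
  | leaf => rfl
  | node L mk R hL hR =>
    have h1 := L.one_le_leaves
    have h2 := R.one_le_leaves
    have hL := hL hT.1
    have hR := hR hT.2.1
    have h3 := hT.2.2
    have h4 := (one_lt_leaves_toFans_iff (node L mk R)).2 (by rw [leaves_node]; omega)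
    rw [fans, if_pos h4, leaves_node, if_pos (by omega : 1 < L.leaves + R.leaves)]
    simp only [fans, one_lt_leaves_toFans_iff] at hL hR
    cases mk
    · have h5 : 1 < L.leaves := by
        by_contra h
        simpa using h3 (by omega)
      simp only [h5, if_true, List.length_cons, toFans, innerFans, List.length_append,
        one_lt_leaves_toFans_iff, chordCount, Bool.false_eq_true, if_false, false_and] at hL hR ⊢
      omega
    · simp only [List.length_cons, toFans, innerFans, List.length_append, List.nil_append,
        one_lt_leaves_toFans_iff, chordCount, if_true, true_and] at hL hR ⊢
      omega

theorem leaves_toFans {T : MarkedTree} (hT : T.Valid) :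
    T.toFans.leaves = T.leaves + T.chordCount + if 1 < T.leaves then 1 else 0 := by
  induction T with
  | leaf => rfl
  | node L mk R hL hR =>
    have h1 := L.one_le_leaves
    have h2 := R.one_le_leaves
    have hL := hL hT.1
    have hR := hR hT.2.1
    have h3 := hT.2.2
    have h4 : 1 < L.leaves + R.leaves := by omega
    simp only [toFans, leaves_node, chordCount, h4, if_true]
    cases mk
    · have h5 : 1 < L.leaves := by
        by_contra h
        simpa using h3 (by omega)
      simp only [Bool.false_eq_true, if_false, false_and, h5, if_true] at *
      omega
    · simp only [if_true, true_and, leaves] at *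
      omega

theorem fans_node (L R : MarkedTree) (mk : Bool) :
    (node L mk R).fans = (L.depth + 1) :: (L.innerFans ++ R.fans) := by
  have h1 := L.one_le_leaves
  have h2 := R.one_le_leaves
  rw [fans, leaves_node, if_pos (by omega)]
  rfl

theorem depth_eq_zero_iff {T : MarkedTree} : T.depth = 0 ↔ T = leaf := by
  cases T <;> simp [depth]

theorem toFans_eq_leaf_iff {T : MarkedTree} : T.toFans = leaf ↔ T = leaf := by
  cases T <;> simp [toFans]

theorem Valid.left_ne_leaf {L R : MarkedTree} (h : (node L false R).Valid) : L ≠ leaf := by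
  rintro rfl
  simpa using h.2.2 rfl

theorem one_notMem_fans_toFans {T : MarkedTree} (hT : T.Valid) : 1 ∉ T.toFans.fans := by
  induction T with
  | leaf => simp [toFans, fans, leaves]
  | node L mk R hL hR =>
    have hL := hL hT.1
    have hR := hR hT.2.1
    rw [toFans, fans_node]
    cases mk
    · have h : L.toFans.depth ≠ 0 := by
        rw [Ne, depth_eq_zero_iff, toFans_eq_leaf_iff]
        exact hT.left_ne_leaf
      have h' : 1 ∉ L.toFans.innerFans := fun hm => hL <| by
        cases hc : L.toFans with
        | leaf => simp [hc, innerFans] at hm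
        | node A mk B => rw [hc, innerFans] at hm; rw [fans_node]; exact List.mem_cons_of_mem _ hm
      simp only [Bool.false_eq_true, if_false, List.mem_cons, List.mem_append]
      rintro (h0 | h0 | h0)
      · omega
      · exact h' h0
      · exact hR h0
    · simp only [if_true, List.mem_cons, List.mem_append, depth, innerFans, List.nil_append]
      rintro (h0 | h0 | h0)
      · omega
      · exact hL h0
      · exact hR h0

theorem left_toFans_ne_leaf {L R A B : MarkedTree} {mk mk' : Bool} (h : (node L mk R).Valid)
    (he : (node L mk R).toFans = node A mk' B) : A ≠ leaf := by
  rintro rfl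
  simp only [toFans, node.injEq] at he
  cases mk
  · exact h.left_ne_leaf (toFans_eq_leaf_iff.1 (by simpa using he.1))
  · simp at he

theorem toFans_ne_node_leaf {T B : MarkedTree} {mk : Bool} (h : T.Valid) :
    T.toFans ≠ node leaf mk B := by
  cases T with
  | leaf => simp [toFans]
  | node L mk R => exact fun he => left_toFans_ne_leaf h he rfl

theorem toFans_injOn : Set.InjOn toFans {T | T.Valid} := by
  intro T hT T' hT' h
  induction T generalizing T' with
  | leaf => exact (toFans_eq_leaf_iff.1 h.symm).symm
  | node L mk R hL hR =>
    cases T' with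
    | leaf => simp [toFans] at h
    | node L' mk' R' =>
      simp only [toFans, node.injEq, true_and] at h
      rw [hR hT.2.1 hT'.2.1 h.2]
      have h := h.1
      cases mk <;> cases mk'
      · rw [hL hT.1 hT'.1 (by simpa using h)]
      · exact (toFans_ne_node_leaf hT.1 (by simpa using h)).elim
      · exact (toFans_ne_node_leaf hT'.1 (by simpa using h.symm)).elim
      · rw [hL hT.1 hT'.1 (by simpa using h)]

theorem exists_toFans_eq {P : MarkedTree} (hP : P.AllMarked) (h1 : 1 ∉ P.fans) :
    ∃ T : MarkedTree, T.Valid ∧ T.toFans = P := by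
  match P, hP, h1 with
  | leaf, _, _ => exact ⟨leaf, trivial, rfl⟩
  | node leaf _ B, _, h1 => simp [fans_node, depth] at h1
  | node (node leaf m C) mk B, hP, h1 =>
    obtain ⟨⟨-, hC, rfl⟩, hB, rfl⟩ := hP
    rw [fans_node] at h1
    obtain ⟨R, hR, rfl⟩ := exists_toFans_eq hB fun h => h1 (by simp [h])
    obtain ⟨L, hL, rfl⟩ := exists_toFans_eq hC fun h => h1 (by
      rw [fans] at h
      simp [innerFans, h])
    exact ⟨node L true R, ⟨hL, hR, fun _ => rfl⟩, by simp [toFans]⟩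
  | node (node (node A m' D) m C) mk B, hP, h1 =>
    obtain ⟨hA, hB, rfl⟩ := hP
    rw [fans_node] at h1
    obtain ⟨R, hR, rfl⟩ := exists_toFans_eq hB fun h => h1 (by simp [h])
    obtain ⟨L, hL, hLe⟩ := exists_toFans_eq hA fun h => h1 (by
      rw [fans_node, List.mem_cons] at h
      rcases h with h | h
      · simp [depth] at h
      · exact List.mem_cons_of_mem _ (List.mem_append_left _ h))
    refine ⟨node L false R, ⟨hL, hR, fun h => ?_⟩, by simp [toFans, hLe]⟩
    rw [eq_leaf_of_leaves_eq_one h] at hLe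
    simp [toFans] at hLe

/-! ### The two bijections -/

/-- Valid marked trees with `w` leaves encoding `k` chords. -/
def treeSet (w k : ℕ) : Set MarkedTree := {T | T.Valid ∧ T.leaves = w ∧ T.chordCount = k}

theorem bijOn_chords_disSet {w : ℕ} (hw : 1 ≤ w) (k : ℕ) :
    Set.BijOn (chords 1) (treeSet w k) (DisSet (w + 1) k) := by
  refine ⟨?_, ?_, ?_⟩
  · rintro T ⟨-, hl, hk⟩
    exact ⟨isDissection_chords hl, (card_chords T 1).trans hk⟩
  · rintro T ⟨hT, hl, -⟩ T' ⟨hT', hl', -⟩ h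
    exact eq_of_chords_eq hT hT' (hl.trans hl'.symm) h
  · rintro S ⟨hS, hk⟩
    obtain ⟨T, hT, hl, rfl⟩ := exists_of_isDissection hw hS
    exact ⟨T, ⟨hT, hl, (card_chords T 1).symm.trans hk⟩, rfl⟩

theorem bijOn_chords_toFans_triSet {w : ℕ} (hw : 1 < w) (k : ℕ) :
    Set.BijOn (fun T => chords 1 T.toFans) (treeSet w k) (TriSet (w + k + 1 + 1) (k + 1) 0) := by
  have hleaves : ∀ T ∈ treeSet w k, T.toFans.leaves = w + k + 1 := by
    rintro T ⟨hT, hl, hk⟩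
    rw [leaves_toFans hT, hl, hk, if_pos hw]
  refine ⟨?_, ?_, ?_⟩
  · intro T hT
    refine (chords_mem_triSet_iff (allMarked_toFans T).valid (hleaves T hT)).2
      ⟨allMarked_toFans T, ?_, one_notMem_fans_toFans hT.1⟩
    rw [length_fans_toFans hT.1, hT.2.1, hT.2.2, if_pos hw]
  · intro T hT T' hT' h
    exact toFans_injOn hT.1 hT'.1 (eq_of_chords_eq (allMarked_toFans T).valid
      (allMarked_toFans T').valid ((hleaves T hT).trans (hleaves T' hT').symm) h)
  · intro S hS
    obtain ⟨P, hP, hl, rfl⟩ := exists_of_isDissection (by omega) hS.1.1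
    obtain ⟨hA, hlen, h1⟩ := (chords_mem_triSet_iff hP hl).1 hS
    obtain ⟨T, hT, rfl⟩ := exists_toFans_eq hA h1
    rw [length_fans_toFans hT] at hlen
    rw [leaves_toFans hT] at hl
    have h2 : 1 < T.leaves := by
      by_contra h
      rw [if_neg h] at hl hlen
      omega
    rw [if_pos h2] at hl hlen
    exact ⟨T, ⟨hT, by omega, by omega⟩, rfl⟩

end MarkedTree

/-- For all integers `n`, `i` with `1 ≤ i ≤ n - 1`, `Dis(n+2, i)` and
`Tri(n+i+3, i+1, 0)` have the same cardinality. -/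
theorem dis_equiv_tri (n i : ℕ) (hi : 1 ≤ i) (hin : i + 1 ≤ n) :
    Nonempty (↥(DisSet (n + 2) i) ≃ ↥(TriSet (n + i + 3) (i + 1) 0)) := by
  have h1 := MarkedTree.bijOn_chords_disSet (w := n + 1) (by omega) i
  have h2 := MarkedTree.bijOn_chords_toFans_triSet (w := n + 1) (by omega) i
  rw [show n + 1 + i + 1 + 1 = n + i + 3 by omega] at h2
  exact ⟨(Set.BijOn.equiv _ h1).symm.trans (Set.BijOn.equiv _ h2)⟩
end

section
/- For all integers a ≥ 2, b ≥ 2 and i ≥ 1, the sets Skyt(a,i,b) and Skyt(b,i,a) have the same cardinality. -/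
/-! ## Rotation by a half turn -/

/-- Half-turn of the cells of the diagram. -/
def skytRot (a i b : ℕ) (c : ℕ × ℕ) : ℕ × ℕ := (a + b - 3 - c.1, i - c.2)

theorem mem_skytCells {a i b : ℕ} {c : ℕ × ℕ} :
    c ∈ skytCells a i b ↔
      (c.1 < a + b - 2 ∧ c.2 < i + 1) ∧ (c.1 + 2 < b → c.2 = i) ∧ (b ≤ c.1 → c.2 = 0) := by
  simp [skytCells]

theorem skytRot_mem {a i b : ℕ} {c : ℕ × ℕ} (hc : c ∈ skytCells a i b) :
    skytRot a i b c ∈ skytCells b i a := by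
  simp only [mem_skytCells, skytRot] at *
  omega

theorem skytRot_skytRot {a i b : ℕ} {c : ℕ × ℕ} (hc : c ∈ skytCells a i b) :
    skytRot b i a (skytRot a i b c) = c := by
  rw [mem_skytCells] at hc
  ext <;> simp only [skytRot] <;> omega

/-- Rotate a filling by a half turn and complement its entries. -/
def skytFlip (a i b : ℕ) (f : ℕ × ℕ → ℕ) (c : ℕ × ℕ) : ℕ :=
  if c ∈ skytCells b i a then a + b + 2 * i - 1 - f (skytRot b i a c) else 0

theorem SkytSet.mem_Icc {a i b : ℕ} {f : ℕ × ℕ → ℕ} (hf : f ∈ SkytSet a i b) {c : ℕ × ℕ}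
    (hc : c ∈ skytCells a i b) : 1 ≤ f c ∧ f c ≤ a + b + 2 * i - 2 := by
  simpa using hf.2.1.mapsTo hc

theorem skytFlip_mem {a i b : ℕ} {f : ℕ × ℕ → ℕ} (hf : f ∈ SkytSet a i b) :
    skytFlip a i b f ∈ SkytSet b i a := by
  have hbound {c : ℕ × ℕ} (hc : c ∈ skytCells b i a) := SkytSet.mem_Icc hf (skytRot_mem hc)
  obtain ⟨-, hbij, hrow, hcol⟩ := hf
  refine ⟨fun c hc => if_neg hc, ⟨fun c hc => ?_, fun c hc d hd h => ?_, fun n hn => ?_⟩,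
    fun c hc d hd h hlt => ?_, fun c hc d hd h hlt => ?_⟩
  · have hc' : c ∈ skytCells b i a := hc
    have := hbound hc'
    simp only [skytFlip, if_pos hc', Finset.coe_Icc, Set.mem_Icc]
    omega
  · have hc' : c ∈ skytCells b i a := hc
    have hd' : d ∈ skytCells b i a := hd
    have h₁ := hbound hc'
    have h₂ := hbound hd'
    simp only [skytFlip, if_pos hc', if_pos hd'] at h
    rw [← skytRot_skytRot hc', ← skytRot_skytRot hd',
      hbij.injOn (skytRot_mem hc') (skytRot_mem hd') (by omega)]
  · simp only [Finset.coe_Icc, Set.mem_Icc] at hn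
    obtain ⟨c, hc, h⟩ := hbij.surjOn
      (show a + b + 2 * i - 1 - n ∈ (Finset.Icc 1 (a + b + 2 * i - 2) : Set ℕ) by
        simp only [Finset.coe_Icc, Set.mem_Icc]; omega)
    have hc' : c ∈ skytCells a i b := hc
    refine ⟨skytRot a i b c, skytRot_mem hc', ?_⟩
    rw [skytFlip, if_pos (skytRot_mem hc'), skytRot_skytRot hc', h]
    omega
  · have h₁ := hbound hc
    have h₂ := hbound hd
    have := hrow _ (skytRot_mem hd) _ (skytRot_mem hc) (by simp only [skytRot, h])
      (by rw [mem_skytCells] at hc hd; simp only [skytRot]; omega)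
    simp only [skytFlip, if_pos hc, if_pos hd]
    omega
  · have h₁ := hbound hc
    have h₂ := hbound hd
    have := hcol _ (skytRot_mem hd) _ (skytRot_mem hc) (by simp only [skytRot, h])
      (by rw [mem_skytCells] at hc hd; simp only [skytRot]; omega)
    simp only [skytFlip, if_pos hc, if_pos hd]
    omega

theorem skytFlip_skytFlip {a i b : ℕ} {f : ℕ × ℕ → ℕ} (hf : f ∈ SkytSet a i b) :
    skytFlip b i a (skytFlip a i b f) = f := by
  funext c
  by_cases hc : c ∈ skytCells a i b
  · have := SkytSet.mem_Icc hf hc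
    simp only [skytFlip, if_pos hc, if_pos (skytRot_mem hc), skytRot_skytRot hc]
    omega
  · rw [skytFlip, if_neg hc, hf.1 c hc]

/-- For all integers `a, b ≥ 2` and `i ≥ 1`, `Skyt(a,i,b)` and `Skyt(b,i,a)` have the
same cardinality. -/
theorem skyt_symm (a b i : ℕ) (ha : 2 ≤ a) (hb : 2 ≤ b) (hi : 1 ≤ i) :
    Nonempty (↥(SkytSet a i b) ≃ ↥(SkytSet b i a)) := by
  exact ⟨{
    toFun := fun f => ⟨skytFlip a i b f, skytFlip_mem f.2⟩
    invFun := fun f => ⟨skytFlip b i a f, skytFlip_mem f.2⟩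
    left_inv := fun f => Subtype.ext (skytFlip_skytFlip f.2)
    right_inv := fun f => Subtype.ext (skytFlip_skytFlip f.2) }⟩
end
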